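/- arXiv:1911.02181 — 2 statements merged into one kernel-verified Lean document; each statement's English description precedes it below -/
import Mathlib

section
/- Let n ≥ 2, and let W⁻, W⁺ be n×n real symmetric matrices with zero diagonal and nonnegative off-diagonal entries such that W⁻(i,j) ≤ W⁺(i,j) for all i,j and such that every pair of indices i,j ∈ {1,…,n} is W⁻-connected. Let G⁻ (resp. G⁺) denote the inverse of a matrix distributed according to ν̃_n^{W⁻,0} (resp. ν̃_n^{W⁺,0}). Then for every convex function f : [0,∞) → ℝ, every index i ∈ {1,…,n} and every vector X ∈ [0,∞)^n such that both expectations below are finite, one has E[f((Σ_{j=1}^n X_j G⁻(i,j))/G⁻(i,i))] ≥ E[f((Σ_{j=1}^n X_j G⁺(i,j))/G⁺(i,i))], where each expectation is the integral of the corresponding functional of G against ν̃_n^{W⁻,0} and ν̃_n^{W⁺,0} respectively. -/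
open scoped Classical

open MeasureTheory Matrix

noncomputable instance matrixMeasurableSpace {m n : Type*} :
    MeasurableSpace (Matrix m n ℝ) :=
  (inferInstance : MeasurableSpace (m → n → ℝ))

noncomputable def Hmat {n : ℕ} (W : Matrix (Fin n) (Fin n) ℝ) (β : Fin n → ℝ) :
    Matrix (Fin n) (Fin n) ℝ :=
  fun i j => if i = j then 2 * β i - W i i else - W i j

noncomputable def nuDensity {n : ℕ} (W : Matrix (Fin n) (Fin n) ℝ) (η : Fin n → ℝ)
    (β : Fin n → ℝ) : ℝ :=
  if (Hmat W β).PosDef then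
    (2 / Real.pi) ^ ((n : ℝ) / 2) *
      Real.exp (-(1/2) * ((∑ i, ∑ j, Hmat W β i j)
        + (η ⬝ᵥ ((Hmat W β)⁻¹ *ᵥ η)) - 2 * ∑ i, η i)) *
      (Real.sqrt (Hmat W β).det)⁻¹
  else 0

/-- The measure ν_n^{W,η} on ℝ^n. -/
noncomputable def nuMeasure {n : ℕ} (W : Matrix (Fin n) (Fin n) ℝ) (η : Fin n → ℝ) :
    Measure (Fin n → ℝ) :=
  volume.withDensity (fun β => ENNReal.ofReal (nuDensity W η β))

/-- The measure ν̃_n^{W,η}: pushforward of ν_n^{W,η} under β ↦ H_β. -/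
noncomputable def nuTilde {n : ℕ} (W : Matrix (Fin n) (Fin n) ℝ) (η : Fin n → ℝ) :
    Measure (Matrix (Fin n) (Fin n) ℝ) :=
  (nuMeasure W η).map (Hmat W)

/-- Indices i and j are H-connected. -/
def HConnected {n : ℕ} (H : Matrix (Fin n) (Fin n) ℝ) (i j : Fin n) : Prop :=
  Relation.ReflTransGen (fun a b => H a b ≠ 0) i j

set_option linter.unusedSectionVars false

namespace VRJP

open scoped ENNReal

section Blocks

variable {A B : Type*} [Fintype A] [Fintype B] [DecidableEq A] [DecidableEq B]

theorem posDef_fromBlocks {P : Matrix A A ℝ} {Q : Matrix A B ℝ} {R : Matrix B B ℝ} :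
    (fromBlocks P (-Q) (-Qᵀ) R).PosDef ↔ P.PosDef ∧ (R - Qᵀ * P⁻¹ * Q).PosDef := by
  have key : P.PosDef →
      ((fromBlocks P (-Q) (-Qᵀ) R).PosDef ↔ (R - Qᵀ * P⁻¹ * Q).PosDef) := by
    intro hP
    have hu := hP.isUnit
    let _ : Invertible P := hu.invertible
    have h1 := PosDef.fromBlocks₁₁ (-Q) R hP
    have h2 : (-Q)ᴴ = -Qᵀ := by ext; simp
    rw [h2] at h1
    have h3 := det_fromBlocks₁₁ P (-Q) (-Qᵀ) R
    have h4 : R - -Qᵀ * P⁻¹ * -Q = R - Qᵀ * P⁻¹ * Q := by simp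
    rw [invOf_eq_nonsing_inv, h4] at h3
    rw [h4] at h1
    constructor
    · intro h
      refine ((h1.1 h.posSemidef).posDef_iff_det_ne_zero).2 fun h0 => ?_
      rw [h0, mul_zero] at h3
      exact h.det_pos.ne' h3
    · intro h
      refine ((h1.2 h.posSemidef).posDef_iff_det_ne_zero).2 ?_
      rw [h3]
      exact mul_ne_zero hP.det_pos.ne' h.det_pos.ne'
  constructor
  · intro h
    have hP : P.PosDef := by
      have := h.submatrix (e := (Sum.inl : A → A ⊕ B)) Sum.inl_injective
      exact this
    exact ⟨hP, (key hP).1 h⟩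
  · rintro ⟨hP, h⟩
    exact (key hP).2 h

theorem det_fromBlocks_schur {P : Matrix A A ℝ} (hP : P.PosDef) (Q : Matrix A B ℝ)
    (R : Matrix B B ℝ) :
    (fromBlocks P (-Q) (-Qᵀ) R).det = P.det * (R - Qᵀ * P⁻¹ * Q).det := by
  let _ : Invertible P := hP.isUnit.invertible
  rw [det_fromBlocks₁₁, invOf_eq_nonsing_inv]
  simp

theorem inv_mulVec_eq {ι : Type*} [Fintype ι] [DecidableEq ι] {H : Matrix ι ι ℝ}
    (hH : H.PosDef) {y η : ι → ℝ} (h : H *ᵥ y = η) : H⁻¹ *ᵥ η = y := by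
  rw [← h, mulVec_mulVec, nonsing_inv_mul _ ((isUnit_iff_isUnit_det _).1 hH.isUnit), one_mulVec]

theorem mulVec_inv_mulVec {ι : Type*} [Fintype ι] [DecidableEq ι] {H : Matrix ι ι ℝ}
    (hH : H.PosDef) (η : ι → ℝ) : H *ᵥ (H⁻¹ *ᵥ η) = η := by
  rw [mulVec_mulVec, mul_nonsing_inv _ ((isUnit_iff_isUnit_det _).1 hH.isUnit), one_mulVec]

theorem inv_fromBlocks_mulVec {P : Matrix A A ℝ} {Q : Matrix A B ℝ} {R : Matrix B B ℝ}
    (hH : (fromBlocks P (-Q) (-Qᵀ) R).PosDef) (ηA : A → ℝ) (ηB : B → ℝ) :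
    (fromBlocks P (-Q) (-Qᵀ) R)⁻¹ *ᵥ Sum.elim ηA ηB =
      Sum.elim
        (P⁻¹ *ᵥ (ηA + Q *ᵥ ((R - Qᵀ * P⁻¹ * Q)⁻¹ *ᵥ (ηB + Qᵀ *ᵥ (P⁻¹ *ᵥ ηA)))))
        ((R - Qᵀ * P⁻¹ * Q)⁻¹ *ᵥ (ηB + Qᵀ *ᵥ (P⁻¹ *ᵥ ηA))) := by
  obtain ⟨hP, hS⟩ := posDef_fromBlocks.1 hH
  refine inv_mulVec_eq hH ?_
  rw [fromBlocks_mulVec]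
  simp only [Function.comp_def, Sum.elim_inl, Sum.elim_inr]
  have h2 := mulVec_inv_mulVec hS (ηB + Qᵀ *ᵥ (P⁻¹ *ᵥ ηA))
  set y := (R - Qᵀ * P⁻¹ * Q)⁻¹ *ᵥ (ηB + Qᵀ *ᵥ (P⁻¹ *ᵥ ηA)) with hy
  rw [sub_mulVec, ← mulVec_mulVec, ← mulVec_mulVec] at h2
  congr 1
  · change P *ᵥ (P⁻¹ *ᵥ _) + (-Q) *ᵥ y = _
    rw [mulVec_inv_mulVec hP, neg_mulVec]
    abel
  · change (-Qᵀ) *ᵥ (P⁻¹ *ᵥ _) + R *ᵥ y = _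
    rw [neg_mulVec, mulVec_add, mulVec_add]
    rw [sub_eq_iff_eq_add] at h2
    rw [h2]
    abel

theorem dotProduct_inv_symm {ι : Type*} [Fintype ι] [DecidableEq ι] {P : Matrix ι ι ℝ}
    (hP : P.PosDef) (x y : ι → ℝ) : x ⬝ᵥ (P⁻¹ *ᵥ y) = (P⁻¹ *ᵥ x) ⬝ᵥ y := by
  have : (P⁻¹)ᵀ = P⁻¹ := by
    have := hP.inv.isHermitian.eq
    rwa [conjTranspose_eq_transpose_of_trivial] at this
  rw [dotProduct_mulVec, ← mulVec_transpose, this]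

theorem dotProduct_inv_fromBlocks {P : Matrix A A ℝ} {Q : Matrix A B ℝ} {R : Matrix B B ℝ}
    (hH : (fromBlocks P (-Q) (-Qᵀ) R).PosDef) (xA ηA : A → ℝ) (xB ηB : B → ℝ) :
    Sum.elim xA xB ⬝ᵥ ((fromBlocks P (-Q) (-Qᵀ) R)⁻¹ *ᵥ Sum.elim ηA ηB) =
      xA ⬝ᵥ (P⁻¹ *ᵥ ηA) + (xB + Qᵀ *ᵥ (P⁻¹ *ᵥ xA)) ⬝ᵥ
        ((R - Qᵀ * P⁻¹ * Q)⁻¹ *ᵥ (ηB + Qᵀ *ᵥ (P⁻¹ *ᵥ ηA))) := by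
  rw [inv_fromBlocks_mulVec hH]
  obtain ⟨hP, hS⟩ := posDef_fromBlocks.1 hH
  set y := (R - Qᵀ * P⁻¹ * Q)⁻¹ *ᵥ (ηB + Qᵀ *ᵥ (P⁻¹ *ᵥ ηA)) with hy
  rw [sumElim_dotProduct_sumElim, mulVec_add, dotProduct_add, add_dotProduct,
    dotProduct_inv_symm hP xA (Q *ᵥ y), dotProduct_mulVec _ Q, mulVec_transpose Q]
  ring

end Blocks

theorem sum_fromBlocks {A B : Type*} [Fintype A] [Fintype B] (P : Matrix A A ℝ)
    (Q : Matrix A B ℝ) (R : Matrix B B ℝ) :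
    ∑ i, ∑ j, fromBlocks P (-Q) (-Qᵀ) R i j =
      ∑ i, ∑ j, P i j - 2 * ∑ i, (Q *ᵥ 1) i + ∑ i, ∑ j, R i j := by
  simp only [Fintype.sum_sum_type, fromBlocks_apply₁₁, fromBlocks_apply₁₂, fromBlocks_apply₂₁,
    fromBlocks_apply₂₂, Finset.sum_add_distrib, Matrix.neg_apply, Finset.sum_neg_distrib,
    transpose_apply, mulVec, dotProduct, Pi.one_apply, mul_one]
  rw [Finset.sum_comm (f := fun (x : B) (y : A) => Q y x)]
  ring

/-- The unnormalised density of `ν^{W,η}` as a function of the matrix `H`. -/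
noncomputable def dens {ι : Type*} [Fintype ι] [DecidableEq ι] (H : Matrix ι ι ℝ) (η : ι → ℝ) :
    ℝ≥0∞ :=
  if H.PosDef then
    ENNReal.ofReal (Real.exp (-(1/2) * ((∑ i, ∑ j, H i j) + (η ⬝ᵥ (H⁻¹ *ᵥ η)) - 2 * ∑ i, η i)) *
      (Real.sqrt H.det)⁻¹)
  else 0

theorem dens_fromBlocks {A B : Type*} [Fintype A] [Fintype B] [DecidableEq A] [DecidableEq B]
    (P : Matrix A A ℝ) (Q : Matrix A B ℝ) (R : Matrix B B ℝ) (ηA : A → ℝ) (ηB : B → ℝ) :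
    dens (fromBlocks P (-Q) (-Qᵀ) R) (Sum.elim ηA ηB) =
      dens P (ηA + Q *ᵥ 1) * dens (R - Qᵀ * P⁻¹ * Q) (ηB + Qᵀ *ᵥ (P⁻¹ *ᵥ ηA)) := by
  unfold dens
  by_cases hH : (fromBlocks P (-Q) (-Qᵀ) R).PosDef
  · obtain ⟨hP, hS⟩ := posDef_fromBlocks.1 hH
    rw [if_pos hH, if_pos hP, if_pos hS, ← ENNReal.ofReal_mul (by positivity)]
    congr 1
    rw [dotProduct_inv_fromBlocks hH, det_fromBlocks_schur hP, sum_fromBlocks,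
      Real.sqrt_mul hP.det_pos.le, mul_inv, mul_mul_mul_comm, ← Real.exp_add]
    congr 2
    have e1 : ∑ i, ∑ j, (R - Qᵀ * P⁻¹ * Q) i j =
        ∑ i, ∑ j, R i j - (Q *ᵥ 1) ⬝ᵥ (P⁻¹ *ᵥ (Q *ᵥ 1)) := by
      have h : ∀ M : Matrix B B ℝ, ∑ i, ∑ j, M i j = 1 ⬝ᵥ (M *ᵥ 1) := fun M => by
        simp [dotProduct, mulVec]
      rw [h, h, sub_mulVec, dotProduct_sub, ← mulVec_mulVec, ← mulVec_mulVec,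
        dotProduct_mulVec _ Qᵀ, vecMul_transpose]
    have e2 : ∀ v : B → ℝ, ∑ i, v i = v ⬝ᵥ 1 := fun v => by simp [dotProduct]
    have e3 : ∑ i, (Qᵀ *ᵥ (P⁻¹ *ᵥ ηA)) i = ηA ⬝ᵥ (P⁻¹ *ᵥ (Q *ᵥ 1)) := by
      rw [e2, dotProduct_comm, dotProduct_mulVec, vecMul_transpose, dotProduct_inv_symm hP,
        dotProduct_comm, dotProduct_inv_symm hP, dotProduct_comm,
        dotProduct_inv_symm hP, dotProduct_comm, dotProduct_inv_symm hP]
    have e4 := dotProduct_inv_symm hP (Q *ᵥ 1) ηA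
    rw [dotProduct_comm (P⁻¹ *ᵥ _)] at e4
    rw [e1]
    simp only [Fintype.sum_sum_type, Sum.elim_inl, Sum.elim_inr, Pi.add_apply,
      Finset.sum_add_distrib, mulVec_add, dotProduct_add, add_dotProduct]
    rw [e3, e4]
    ring
  · rw [if_neg hH]
    have := mt posDef_fromBlocks.2 hH
    rw [not_and_or] at this
    rcases this with h | h <;> simp [h]

/-- The inverse Gaussian density with mean `1` and shape `k`, up to the factor `√(2π)`. -/
noncomputable def igDensity (k r : ℝ) : ℝ :=
  Real.sqrt k * (r * Real.sqrt r)⁻¹ * Real.exp (-(k / 2) * (r + 1 / r - 2))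

/-- The total mass of `igDensity`. -/
noncomputable def gaussMass : ℝ≥0∞ := ∫⁻ x : ℝ, ENNReal.ofReal (Real.exp (-(1 / 2) * x ^ 2))

theorem gaussMass_ne_top : gaussMass ≠ ∞ := by
  have h := (integrable_exp_neg_mul_sq (b := 1 / 2) (by norm_num)).lintegral_lt_top
  exact h.ne

theorem igDensity_nonneg {k r : ℝ} (hr : 0 < r) : 0 ≤ igDensity k r := by
  unfold igDensity; positivity

theorem measurable_igDensity (k : ℝ) : Measurable (igDensity k) := by
  unfold igDensity; fun_prop

theorem lintegral_igDensity_inv (k : ℝ) :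
    ∫⁻ r in Set.Ioi (0 : ℝ), ENNReal.ofReal (igDensity k r) =
      ∫⁻ r in Set.Ioi (0 : ℝ), ENNReal.ofReal (igDensity k r * r) := by
  have himg : (fun r : ℝ => r⁻¹) '' Set.Ioi 0 = Set.Ioi 0 := by
    ext x
    constructor
    · rintro ⟨y, hy, rfl⟩
      exact inv_pos.2 (Set.mem_Ioi.1 hy)
    · intro hx
      exact ⟨x⁻¹, inv_pos.2 (Set.mem_Ioi.1 hx), inv_inv x⟩
  have h := lintegral_image_eq_lintegral_abs_deriv_mul (s := Set.Ioi (0 : ℝ))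
    (f := fun r => r⁻¹) (f' := fun r => -(r ^ 2)⁻¹) measurableSet_Ioi
    (fun x hx => (hasDerivAt_inv (Set.mem_Ioi.1 hx).ne').hasDerivWithinAt)
    inv_injective.injOn (fun r => ENNReal.ofReal (igDensity k r))
  rw [himg] at h
  rw [h]
  refine setLIntegral_congr_fun measurableSet_Ioi fun r hr => ?_
  have hr : 0 < r := hr
  rw [← ENNReal.ofReal_mul (abs_nonneg _)]
  congr 1
  unfold igDensity
  rw [abs_neg, abs_of_pos (by positivity), Real.sqrt_inv, one_div, inv_inv, one_div,
    add_comm r⁻¹ r]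
  have hs := Real.sq_sqrt hr.le
  have hs0 : 0 < Real.sqrt r := Real.sqrt_pos.2 hr
  field_simp
  rw [hs, mul_comm]

theorem lintegral_igDensity_add {k : ℝ} (hk : 0 < k) :
    ∫⁻ r in Set.Ioi (0 : ℝ), ENNReal.ofReal ((igDensity k r + igDensity k r * r) / 2) =
      gaussMass := by
  set f : ℝ → ℝ := fun r => Real.sqrt k * (Real.sqrt r - (Real.sqrt r)⁻¹) with hf
  have hsk : 0 < Real.sqrt k := Real.sqrt_pos.2 hk
  have himg : f '' Set.Ioi 0 = Set.univ := by
    refine Set.eq_univ_of_forall fun x => ?_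
    set y := x / Real.sqrt k with hy
    set u := Real.sqrt (y ^ 2 + 4) with hu
    have hu2 : u ^ 2 = y ^ 2 + 4 := Real.sq_sqrt (by positivity)
    have huy : |y| < u := by
      rw [hu, ← Real.sqrt_sq_eq_abs]
      exact Real.sqrt_lt_sqrt (sq_nonneg _) (by linarith)
    have hpos : 0 < (y + u) / 2 := by
      have := neg_abs_le y
      linarith
    refine ⟨((y + u) / 2) ^ 2, by simp only [Set.mem_Ioi]; positivity, ?_⟩
    simp only [hf]
    rw [Real.sqrt_sq hpos.le]
    have : (y + u) / 2 - ((y + u) / 2)⁻¹ = y := by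
      have : y + u ≠ 0 := by linarith
      field_simp
      nlinarith
    rw [this, hy]
    field_simp
  have hmono : StrictMonoOn f (Set.Ioi 0) := by
    intro a ha b hb hab
    have ha : 0 < a := ha
    have h1 := Real.sqrt_lt_sqrt ha.le hab
    have h2 : (Real.sqrt b)⁻¹ < (Real.sqrt a)⁻¹ :=
      inv_strictAnti₀ (Real.sqrt_pos.2 ha) h1
    exact mul_lt_mul_of_pos_left (by linarith) hsk
  have hder : ∀ r ∈ Set.Ioi (0 : ℝ), HasDerivWithinAt f
      (Real.sqrt k * (1 / (2 * Real.sqrt r) - -(1 / (2 * Real.sqrt r)) / Real.sqrt r ^ 2))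
      (Set.Ioi 0) r := by
    intro r hr
    have hr : 0 < r := hr
    have h1 := Real.hasDerivAt_sqrt hr.ne'
    exact ((h1.sub (h1.inv (Real.sqrt_pos.2 hr).ne')).const_mul _).hasDerivWithinAt
  have h := lintegral_image_eq_lintegral_abs_deriv_mul measurableSet_Ioi hder hmono.injOn
    (fun x => ENNReal.ofReal (Real.exp (-(1 / 2) * x ^ 2)))
  rw [himg, Measure.restrict_univ] at h
  unfold gaussMass
  rw [h]
  refine setLIntegral_congr_fun measurableSet_Ioi fun r hr => ?_
  have hr : 0 < r := hr
  have hs0 : 0 < Real.sqrt r := Real.sqrt_pos.2 hr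
  have hs := Real.sq_sqrt hr.le
  rw [← ENNReal.ofReal_mul (abs_nonneg _)]
  congr 1
  unfold igDensity
  rw [neg_div, sub_neg_eq_add, abs_of_pos (by positivity)]
  have e : -(1 / 2) * f r ^ 2 = -(k / 2) * (r + 1 / r - 2) := by
    simp only [hf]
    rw [mul_pow, Real.sq_sqrt hk.le, sub_sq, inv_pow, hs, mul_assoc 2, mul_inv_cancel₀ hs0.ne']
    ring
  rw [e]
  field_simp
  rw [hs]
  ring

theorem lintegral_igDensity {k : ℝ} (hk : 0 < k) :
    ∫⁻ r in Set.Ioi (0 : ℝ), ENNReal.ofReal (igDensity k r) = gaussMass := by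
  have h1 := lintegral_igDensity_inv k
  have h2 := lintegral_igDensity_add hk
  have h3 : ∫⁻ r in Set.Ioi (0 : ℝ), ENNReal.ofReal ((igDensity k r + igDensity k r * r) / 2) =
      ∫⁻ r in Set.Ioi (0 : ℝ), (ENNReal.ofReal (igDensity k r) * ENNReal.ofReal (1 / 2) +
        ENNReal.ofReal (igDensity k r * r) * ENNReal.ofReal (1 / 2)) := by
    refine setLIntegral_congr_fun measurableSet_Ioi fun r hr => ?_
    have hr : 0 < r := hr
    have := igDensity_nonneg (k := k) hr
    rw [← ENNReal.ofReal_mul this, ← ENNReal.ofReal_mul (by positivity),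
      ← ENNReal.ofReal_add (by positivity) (by positivity)]
    congr 1
    ring
  have hm := measurable_igDensity k
  rw [h3, lintegral_add_left (by fun_prop), lintegral_mul_const _ (by fun_prop),
    lintegral_mul_const _ (by fun_prop), ← h1, ← mul_add, ← ENNReal.ofReal_add (by norm_num)
    (by norm_num)] at h2
  norm_num at h2
  exact h2

theorem lintegral_igDensity_affine {k : ℝ} (hk : 0 < k) {a b : ℝ} (ha : 0 ≤ a) (hb : 0 ≤ b) :
    ∫⁻ r in Set.Ioi (0 : ℝ), ENNReal.ofReal (igDensity k r) * ENNReal.ofReal (a + b * r) =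
      gaussMass * ENNReal.ofReal (a + b) := by
  have h3 : ∫⁻ r in Set.Ioi (0 : ℝ), ENNReal.ofReal (igDensity k r) * ENNReal.ofReal (a + b * r) =
      ∫⁻ r in Set.Ioi (0 : ℝ), (ENNReal.ofReal (igDensity k r) * ENNReal.ofReal a +
        ENNReal.ofReal (igDensity k r * r) * ENNReal.ofReal b) := by
    refine setLIntegral_congr_fun measurableSet_Ioi fun r hr => ?_
    have hr : 0 < r := hr
    have := igDensity_nonneg (k := k) hr
    rw [← ENNReal.ofReal_mul this, ← ENNReal.ofReal_mul this, ← ENNReal.ofReal_mul (by positivity),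
      ← ENNReal.ofReal_add (by positivity) (by positivity)]
    congr 1
    ring
  have hm := measurable_igDensity k
  rw [h3, lintegral_add_left (by fun_prop), lintegral_mul_const _ (by fun_prop),
    lintegral_mul_const _ (by fun_prop), ← lintegral_igDensity_inv, lintegral_igDensity hk,
    ← mul_add, ← ENNReal.ofReal_add ha hb]

/-- The secant through two points lies above a convex function between them and below it
outside. -/
theorem secant_sub_mul_nonneg {g : ℝ → ℝ} (hg : ConvexOn ℝ (Set.Ioi 0) g) {x z r : ℝ}
    (hx : 0 < x) (hxz : x < z) (hr : 0 < r) :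
    0 ≤ (g r - (g x + (g z - g x) / (z - x) * (r - x))) * ((r - x) * (r - z)) := by
  have hz : 0 < z := hx.trans hxz
  have key : (g r - (g x + (g z - g x) / (z - x) * (r - x))) * ((r - x) * (r - z)) =
      (g r * (z - x) - g x * (z - r) - g z * (r - x)) / (z - x) * ((r - x) * (r - z)) := by
    have : z - x ≠ 0 := by linarith
    field_simp
    ring
  have hzx : 0 < z - x := by linarith
  rw [key]
  rcases lt_trichotomy r x with h | h | h
  · have := hg.slope_mono_adjacent (x := r) (y := x) (z := z) hr hz h hxz
    rw [div_le_div_iff₀ (by linarith) (by linarith)] at this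
    exact mul_nonneg (div_nonneg (by linarith) hzx.le)
      (mul_nonneg_of_nonpos_of_nonpos (by linarith) (by linarith))
  · simp [h]
  · rcases lt_trichotomy r z with h' | h' | h'
    · have := hg.slope_mono_adjacent (x := x) (y := r) (z := z) hx hz h h'
      rw [div_le_div_iff₀ (by linarith) (by linarith)] at this
      exact mul_nonneg_of_nonpos_of_nonpos (div_nonpos_of_nonpos_of_nonneg (by linarith) hzx.le)
        (mul_nonpos_of_nonneg_of_nonpos (by linarith) (by linarith))
    · simp [h']
    · have := hg.slope_mono_adjacent (x := x) (y := z) (z := r) hx hr hxz h'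
      rw [div_le_div_iff₀ (by linarith) (by linarith)] at this
      exact mul_nonneg (div_nonneg (by linarith) hzx.le)
        (mul_nonneg (by linarith) (by linarith))

theorem exists_crossing {k k' : ℝ} (hk : 0 < k) (hkk : k < k') :
    ∃ x z : ℝ, 0 < x ∧ x < z ∧ ∀ r, 0 < r →
      ((r - x) * (r - z) ≤ 0 → igDensity k r ≤ igDensity k' r) ∧
      (0 ≤ (r - x) * (r - z) → igDensity k' r ≤ igDensity k r) := by
  have hk' : 0 < k' := hk.trans hkk
  set T := 2 + (Real.log k' - Real.log k) / (k' - k) with hT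
  have hlog : Real.log k < Real.log k' := Real.log_lt_log hk hkk
  have hT2 : 2 < T := by
    have : 0 < (Real.log k' - Real.log k) / (k' - k) := div_pos (by linarith) (by linarith)
    linarith
  set D := Real.sqrt (T ^ 2 - 4) with hD
  have hD0 : 0 < D := Real.sqrt_pos.2 (by nlinarith)
  have hD2 : D ^ 2 = T ^ 2 - 4 := Real.sq_sqrt (by nlinarith)
  have hDT : D < T := by nlinarith
  have hform : ∀ k r : ℝ, 0 < k → 0 < r → igDensity k r =
      (r * Real.sqrt r)⁻¹ * Real.exp (1 / 2 * (Real.log k - k * (r + 1 / r - 2))) := by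
    intro k r hk hr
    unfold igDensity
    have : Real.sqrt k = Real.exp (1 / 2 * Real.log k) := by
      rw [Real.sqrt_eq_rpow, Real.rpow_def_of_pos hk, mul_comm]
    rw [this, mul_comm (Real.exp _), mul_assoc, ← Real.exp_add]
    congr 2
    ring
  refine ⟨(T - D) / 2, (T + D) / 2, by linarith, by linarith, fun r hr => ?_⟩
  have e : (r - (T - D) / 2) * (r - (T + D) / 2) = r * (r + 1 / r - T) := by
    field_simp
    nlinarith
  have hTT : (T - 2) * (k' - k) = Real.log k' - Real.log k := by
    rw [hT]
    have : k' - k ≠ 0 := by linarith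
    field_simp
    ring
  rw [e, hform k r hk hr, hform k' r hk' hr]
  have hc : 0 ≤ (r * Real.sqrt r)⁻¹ := by positivity
  constructor
  · intro h
    have h : r + 1 / r - T ≤ 0 := by
      by_contra h0
      push Not at h0
      exact absurd (mul_pos hr h0) (by linarith)
    refine mul_le_mul_of_nonneg_left (Real.exp_le_exp.2 ?_) hc
    nlinarith
  · intro h
    have h : 0 ≤ r + 1 / r - T := nonneg_of_mul_nonneg_right h hr
    refine mul_le_mul_of_nonneg_left (Real.exp_le_exp.2 ?_) hc
    nlinarith

theorem lintegral_igDensity_convex_anti {k k' : ℝ} (hk : 0 < k) (hkk : k ≤ k') {g : ℝ → ℝ}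
    (hg : ConvexOn ℝ (Set.Ioi 0) g) (hg0 : ∀ r, 0 < r → 0 ≤ g r) :
    ∫⁻ r in Set.Ioi (0 : ℝ), ENNReal.ofReal (igDensity k' r) * ENNReal.ofReal (g r) ≤
      ∫⁻ r in Set.Ioi (0 : ℝ), ENNReal.ofReal (igDensity k r) * ENNReal.ofReal (g r) := by
  rcases hkk.eq_or_lt with rfl | hkk
  · exact le_rfl
  have hk' : 0 < k' := hk.trans hkk
  obtain ⟨x, z, hx, hxz, hcross⟩ := exists_crossing hk hkk
  set s := (g z - g x) / (z - x) with hs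
  set t := g x - s * x with ht
  set ap := max t 0
  set am := max (-t) 0
  set bp := max s 0
  set bm := max (-s) 0
  have hap : 0 ≤ ap := le_max_right _ _
  have ham : 0 ≤ am := le_max_right _ _
  have hbp : 0 ≤ bp := le_max_right _ _
  have hbm : 0 ≤ bm := le_max_right _ _
  have hat : ap - am = t := max_zero_sub_eq_self t
  have hbs : bp - bm = s := max_zero_sub_eq_self s
  have hm := measurable_igDensity k
  have hm' := measurable_igDensity k'
  have hpt : ∀ r ∈ Set.Ioi (0 : ℝ),
      ENNReal.ofReal (igDensity k r) * ENNReal.ofReal (ap + bp * r) +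
        (ENNReal.ofReal (igDensity k' r) * ENNReal.ofReal (am + bm * r) +
        ENNReal.ofReal (igDensity k' r) * ENNReal.ofReal (g r)) ≤
      ENNReal.ofReal (igDensity k' r) * ENNReal.ofReal (ap + bp * r) +
        (ENNReal.ofReal (igDensity k r) * ENNReal.ofReal (am + bm * r) +
        ENNReal.ofReal (igDensity k r) * ENNReal.ofReal (g r)) := by
    intro r hr
    have hr : 0 < r := hr
    have h0 := igDensity_nonneg (k := k) hr
    have h0' := igDensity_nonneg (k := k') hr
    have hg0r := hg0 r hr
    have hc := hcross r hr
    have hsec := secant_sub_mul_nonneg hg hx hxz hr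
    have hmain : 0 ≤ (g r - (t + s * r)) * (igDensity k r - igDensity k' r) := by
      have e : g r - (g x + (g z - g x) / (z - x) * (r - x)) = g r - (t + s * r) := by
        rw [← hs, ht]; ring
      rw [e] at hsec
      rcases lt_trichotomy ((r - x) * (r - z)) 0 with h | h | h
      · have h1 := hc.1 h.le
        have h2 : g r - (t + s * r) ≤ 0 := by
          by_contra h3
          push Not at h3
          exact absurd (mul_neg_of_pos_of_neg h3 h) (by linarith)
        exact mul_nonneg_of_nonpos_of_nonpos h2 (by linarith)
      · have := le_antisymm (hc.1 h.le) (hc.2 h.ge)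
        simp [this]
      · have h1 := hc.2 h.le
        exact mul_nonneg (nonneg_of_mul_nonneg_left hsec h) (by linarith)
    simp only [← ENNReal.ofReal_mul h0, ← ENNReal.ofReal_mul h0']
    have p1 : 0 ≤ ap + bp * r := by positivity
    have p2 : 0 ≤ am + bm * r := by positivity
    rw [← ENNReal.ofReal_add (by positivity) (by positivity),
      ← ENNReal.ofReal_add (by positivity) (by positivity),
      ← ENNReal.ofReal_add (by positivity) (by positivity),
      ← ENNReal.ofReal_add (by positivity) (by positivity)]
    refine ENNReal.ofReal_le_ofReal ?_
    rw [← hat, ← hbs] at hmain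
    nlinarith
  have hint := setLIntegral_mono' (μ := volume) measurableSet_Ioi hpt
  have hfin : ∀ v : ℝ, gaussMass * ENNReal.ofReal v ≠ ∞ := fun v =>
    ENNReal.mul_ne_top gaussMass_ne_top ENNReal.ofReal_ne_top
  rw [lintegral_add_left (by fun_prop), lintegral_add_left (by fun_prop),
    lintegral_add_left (by fun_prop), lintegral_add_left (by fun_prop),
    lintegral_igDensity_affine hk hap hbp, lintegral_igDensity_affine hk' hap hbp,
    lintegral_igDensity_affine hk ham hbm, lintegral_igDensity_affine hk' ham hbm,
    ENNReal.add_le_add_iff_left (hfin _), ENNReal.add_le_add_iff_left (hfin _)] at hint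
  exact hint

section Operator

variable {ι : Type*} [Fintype ι] [DecidableEq ι]

/-- The Schrödinger operator `2β - W`. -/
noncomputable def opMat (W : Matrix ι ι ℝ) (β : ι → ℝ) : Matrix ι ι ℝ :=
  diagonal (fun i => 2 * β i) - W

theorem continuous_opMat (W : Matrix ι ι ℝ) : Continuous (opMat W) := by
  unfold opMat
  fun_prop

theorem measurable_dotProduct_inv (W : Matrix ι ι ℝ) (η X : ι → ℝ) :
    Measurable fun β => X ⬝ᵥ ((opMat W β)⁻¹ *ᵥ η) := by
  have h : (fun β => X ⬝ᵥ ((opMat W β)⁻¹ *ᵥ η)) =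
      fun β => ((opMat W β).det)⁻¹ * (X ⬝ᵥ ((opMat W β).adjugate *ᵥ η)) := by
    ext β
    rw [inv_def, Ring.inverse_eq_inv', smul_mulVec, dotProduct_smul, smul_eq_mul]
  rw [h]
  have hc := continuous_opMat W
  refine (hc.matrix_det.measurable.inv).mul (Continuous.measurable ?_)
  exact continuous_const.dotProduct (hc.matrix_adjugate.matrix_mulVec continuous_const)

theorem measurableSet_posDef (W : Matrix ι ι ℝ) :
    MeasurableSet {β : ι → ℝ | (opMat W β).PosDef} := by
  have hc := continuous_opMat W
  have h : {β : ι → ℝ | (opMat W β).PosDef} =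
      {β : ι → ℝ | (opMat W β).PosSemidef} ∩ {β | (opMat W β).det ≠ 0} := by
    ext β
    exact ⟨fun h => ⟨h.posSemidef, h.det_pos.ne'⟩,
      fun h => (h.1.posDef_iff_det_ne_zero).2 h.2⟩
  rw [h]
  refine MeasurableSet.inter (IsClosed.measurableSet ?_)
    (isOpen_ne_fun hc.matrix_det continuous_const).measurableSet
  simp only [posSemidef_iff_dotProduct_mulVec, Set.ofPred_and, Set.ofPred_forall]
  refine IsClosed.inter ?_ ?_
  · exact isClosed_eq hc.matrix_conjTranspose hc
  · refine isClosed_iInter fun x => ?_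
    exact isClosed_le continuous_const
      (continuous_const.dotProduct (hc.matrix_mulVec continuous_const))

theorem measurable_dens (W : Matrix ι ι ℝ) (η : ι → ℝ) :
    Measurable fun β => dens (opMat W β) η := by
  unfold dens
  have hc := continuous_opMat W
  refine Measurable.ite (measurableSet_posDef W) ?_ measurable_const
  have h1 := measurable_dotProduct_inv W η η
  have h2 : Measurable fun β => ∑ i, ∑ j, opMat W β i j :=
    (continuous_finsetSum _ fun i _ => continuous_finsetSum _ fun j _ =>
      hc.matrix_elem i j).measurable
  have h3 := (Real.continuous_sqrt.comp hc.matrix_det).measurable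
  simp only [Function.comp_def] at h3
  fun_prop

theorem dens_ne_top (H : Matrix ι ι ℝ) (η : ι → ℝ) : dens H η ≠ ∞ := by
  unfold dens
  split_ifs <;> simp

theorem dens_of_not_posDef {H : Matrix ι ι ℝ} (h : ¬ H.PosDef) (η : ι → ℝ) : dens H η = 0 :=
  if_neg h

/-- The integral of `φ(⟨X, H⁻¹ η⟩)` against the unnormalised measure `ν^{W,η}`. -/
noncomputable def schInt (W : Matrix ι ι ℝ) (η X : ι → ℝ) (φ : ℝ → ℝ≥0∞) : ℝ≥0∞ :=
  ∫⁻ β : ι → ℝ, dens (opMat W β) η * φ (X ⬝ᵥ ((opMat W β)⁻¹ *ᵥ η))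

theorem measurable_schInt_integrand (W : Matrix ι ι ℝ) (η X : ι → ℝ) {φ : ℝ → ℝ≥0∞}
    (hφ : Measurable φ) :
    Measurable fun β => dens (opMat W β) η * φ (X ⬝ᵥ ((opMat W β)⁻¹ *ᵥ η)) :=
  (measurable_dens W η).mul (hφ.comp (measurable_dotProduct_inv W η X))

end Operator

section Reindex

variable {ι κ : Type*} [Fintype ι] [DecidableEq ι] [Fintype κ] [DecidableEq κ]

theorem opMat_comp_equiv (e : κ ≃ ι) (W : Matrix ι ι ℝ) (β : ι → ℝ) :
    opMat (W.submatrix e e) (β ∘ e) = (opMat W β).submatrix e e := by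
  ext i j
  simp [opMat, diagonal_apply]

theorem posDef_submatrix_equiv (e : κ ≃ ι) (H : Matrix ι ι ℝ) :
    (H.submatrix e e).PosDef ↔ H.PosDef := by
  constructor
  · intro h
    have := h.submatrix (e := e.symm) e.symm.injective
    simpa using this
  · exact fun h => h.submatrix e.injective

theorem dotProduct_inv_submatrix_equiv (e : κ ≃ ι) (H : Matrix ι ι ℝ) (X η : ι → ℝ) :
    (X ∘ e) ⬝ᵥ ((H.submatrix e e)⁻¹ *ᵥ (η ∘ e)) = X ⬝ᵥ (H⁻¹ *ᵥ η) := by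
  rw [inv_submatrix_equiv, submatrix_mulVec_equiv, Function.comp_assoc, Equiv.self_comp_symm,
    Function.comp_id, comp_equiv_dotProduct_comp_equiv]

theorem dens_submatrix_equiv (e : κ ≃ ι) (H : Matrix ι ι ℝ) (η : ι → ℝ) :
    dens (H.submatrix e e) (η ∘ e) = dens H η := by
  unfold dens
  rw [posDef_submatrix_equiv, dotProduct_inv_submatrix_equiv, det_submatrix_equiv_self]
  have h1 : ∑ i, ∑ j, H.submatrix e e i j = ∑ i, ∑ j, H i j := by
    simp only [submatrix_apply]
    rw [e.sum_comp (fun i => ∑ j, H i (e j))]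
    exact Finset.sum_congr rfl fun i _ => e.sum_comp (fun j => H i j)
  have h2 : ∑ i, (η ∘ e) i = ∑ i, η i := e.sum_comp η
  rw [h1, h2]

theorem lintegral_comp_equiv (e : κ ≃ ι) (F : (κ → ℝ) → ℝ≥0∞) :
    ∫⁻ β : ι → ℝ, F (β ∘ e) = ∫⁻ β : κ → ℝ, F β := by
  have h := volume_measurePreserving_piCongrLeft (fun _ : ι => ℝ) e
  have := h.symm.lintegral_map_equiv F
  rw [this]
  rfl

theorem schInt_submatrix_equiv (e : κ ≃ ι) (W : Matrix ι ι ℝ) (η X : ι → ℝ) (φ : ℝ → ℝ≥0∞) :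
    schInt (W.submatrix e e) (η ∘ e) (X ∘ e) φ = schInt W η X φ := by
  unfold schInt
  rw [← lintegral_comp_equiv e]
  simp only [opMat_comp_equiv, dens_submatrix_equiv, dotProduct_inv_submatrix_equiv]

end Reindex

section Recursion

variable {A B : Type*} [Fintype A] [Fintype B] [DecidableEq A] [DecidableEq B]

theorem lintegral_sum_pi {F : (A ⊕ B → ℝ) → ℝ≥0∞} (hF : Measurable F) :
    ∫⁻ β, F β = ∫⁻ βA : A → ℝ, ∫⁻ βB : B → ℝ, F (Sum.elim βA βB) := by
  have h := volume_measurePreserving_sumPiEquivProdPi_symm (fun _ : A ⊕ B => ℝ)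
  have h1 := h.lintegral_map_equiv F
  rw [h1]
  have h2 : Measurable fun p : (A → ℝ) × (B → ℝ) =>
      F ((MeasurableEquiv.sumPiEquivProdPi (fun _ : A ⊕ B => ℝ)).symm p) :=
    hF.comp (MeasurableEquiv.measurable _)
  rw [Measure.volume_eq_prod, lintegral_prod _ h2.aemeasurable]
  rfl

theorem opMat_fromBlocks (W₁ : Matrix A A ℝ) (Q : Matrix A B ℝ) (W₂ : Matrix B B ℝ)
    (βA : A → ℝ) (βB : B → ℝ) :
    opMat (fromBlocks W₁ Q Qᵀ W₂) (Sum.elim βA βB) =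
      fromBlocks (opMat W₁ βA) (-Q) (-Qᵀ) (opMat W₂ βB) := by
  ext (i | i) (j | j) <;> simp [opMat, diagonal_apply]

theorem opMat_sub (W₂ : Matrix B B ℝ) (K : Matrix B B ℝ) (βB : B → ℝ) :
    opMat W₂ βB - K = opMat (W₂ + K) βB := by
  unfold opMat
  abel

theorem schInt_fromBlocks (W₁ : Matrix A A ℝ) (Q : Matrix A B ℝ) (W₂ : Matrix B B ℝ)
    (ηA XA : A → ℝ) (ηB XB : B → ℝ) {φ : ℝ → ℝ≥0∞} (hφ : Measurable φ) :
    schInt (fromBlocks W₁ Q Qᵀ W₂) (Sum.elim ηA ηB) (Sum.elim XA XB) φ =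
      ∫⁻ βA : A → ℝ, dens (opMat W₁ βA) (ηA + Q *ᵥ 1) *
        schInt (W₂ + Qᵀ * (opMat W₁ βA)⁻¹ * Q) (ηB + Qᵀ *ᵥ ((opMat W₁ βA)⁻¹ *ᵥ ηA))
          (XB + Qᵀ *ᵥ ((opMat W₁ βA)⁻¹ *ᵥ XA))
          (fun z => φ (XA ⬝ᵥ ((opMat W₁ βA)⁻¹ *ᵥ ηA) + z)) := by
  rw [schInt, lintegral_sum_pi (measurable_schInt_integrand _ _ _ hφ)]
  refine lintegral_congr fun βA => ?_
  rw [schInt, ← lintegral_const_mul' _ _ (dens_ne_top _ _)]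
  refine lintegral_congr fun βB => ?_
  rw [opMat_fromBlocks, dens_fromBlocks, opMat_sub, mul_assoc]
  by_cases hP : (opMat W₁ βA).PosDef
  · by_cases hS : (opMat (W₂ + Qᵀ * (opMat W₁ βA)⁻¹ * Q) βB).PosDef
    · rw [dotProduct_inv_fromBlocks, opMat_sub]
      rw [posDef_fromBlocks, opMat_sub]
      exact ⟨hP, hS⟩
    · simp [dens_of_not_posDef hS]
  · simp [dens_of_not_posDef hP]

end Recursion

theorem lintegral_comp_two_mul_sub (w : ℝ) (F : ℝ → ℝ≥0∞) :
    ∫⁻ b : ℝ, F (2 * b - w) = 2⁻¹ * ∫⁻ t, F t := by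
  have h2 := lintegral_image_eq_lintegral_abs_deriv_mul (s := Set.univ) (f := fun b : ℝ => 2 * b - w)
    (f' := fun _ => 2) MeasurableSet.univ
    (fun x _ => by
      have := (((hasDerivAt_id x).const_mul 2).sub_const w).hasDerivWithinAt (s := Set.univ)
      simpa only [mul_one, id] using this)
    (fun x _ y _ hxy => by simpa using hxy) F
  have h3 : (fun b : ℝ => 2 * b - w) '' Set.univ = Set.univ := by
    rw [Set.image_univ, Set.range_eq_univ]
    exact fun t => ⟨(t + w) / 2, by simp; ring⟩
  rw [h3] at h2
  simp only [Measure.restrict_univ, abs_two, ENNReal.ofReal_ofNat] at h2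
  rw [h2, lintegral_const_mul' _ _ (by simp), ← mul_assoc, ENNReal.inv_mul_cancel (by simp) (by simp),
    one_mul]

theorem lintegral_unit_affine (w : ℝ) (F : ℝ → ℝ≥0∞) :
    ∫⁻ β : Unit → ℝ, F (2 * β () - w) = 2⁻¹ * ∫⁻ t, F t := by
  have h := volume_preserving_funUnique Unit ℝ
  rw [h.symm.lintegral_map_equiv (fun β : Unit → ℝ => F (2 * β () - w)),
    ← lintegral_comp_two_mul_sub w]
  rfl

theorem opMat_unit (W : Matrix Unit Unit ℝ) (β : Unit → ℝ) :
    opMat W β = diagonal fun _ => 2 * β () - W () () := by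
  ext
  simp [opMat]

theorem posDef_unit {t : ℝ} : (diagonal fun _ : Unit => t).PosDef ↔ 0 < t := by
  rw [posDef_diagonal_iff]
  simp

theorem inv_unit_mulVec {t : ℝ} (ht : 0 < t) (η : Unit → ℝ) :
    (diagonal fun _ : Unit => t)⁻¹ *ᵥ η = fun _ => η () / t := by
  refine inv_mulVec_eq (posDef_unit.2 ht) ?_
  ext
  simp [mulVec_diagonal]
  field_simp

theorem dens_unit {t : ℝ} (ht : 0 < t) (η : Unit → ℝ) :
    dens (diagonal fun _ : Unit => t) η =
      ENNReal.ofReal (Real.exp (-(1 / 2) * (t + η () * (η () / t) - 2 * η ())) * (√t)⁻¹) := by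
  unfold dens
  rw [if_pos (posDef_unit.2 ht), inv_unit_mulVec ht]
  simp [dotProduct]

theorem lintegral_dens_unit (W : Matrix Unit Unit ℝ) (η : Unit → ℝ)
    (F : Matrix Unit Unit ℝ → ℝ≥0∞) :
    ∫⁻ β : Unit → ℝ, dens (opMat W β) η * F (opMat W β) = 2⁻¹ * ∫⁻ t in Set.Ioi 0,
      ENNReal.ofReal (Real.exp (-(1 / 2) * (t + η () * (η () / t) - 2 * η ())) * (√t)⁻¹) *
        F (diagonal fun _ => t) := by
  simp only [opMat_unit]
  rw [lintegral_unit_affine (W () ()) (fun t => dens (diagonal fun _ => t) η *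
    F (diagonal fun _ => t))]
  rw [← lintegral_indicator measurableSet_Ioi]
  congr 1
  refine lintegral_congr fun t => ?_
  by_cases ht : 0 < t
  · rw [Set.indicator_of_mem (Set.mem_Ioi.2 ht), dens_unit ht]
  · rw [Set.indicator_of_notMem (by simpa using ht), dens_of_not_posDef, zero_mul]
    rwa [posDef_unit]

theorem schInt_unit (W : Matrix Unit Unit ℝ) {η : Unit → ℝ} (X : Unit → ℝ) (hη : 0 < η ())
    (φ : ℝ → ℝ≥0∞) :
    schInt W η X φ =
      2⁻¹ * ∫⁻ r in Set.Ioi 0, ENNReal.ofReal (igDensity (η ()) r) * φ (X () * r) := by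
  rw [schInt, lintegral_dens_unit W η (fun H => φ (X ⬝ᵥ (H⁻¹ *ᵥ η)))]
  have h2 := lintegral_image_eq_lintegral_abs_deriv_mul (s := Set.Ioi 0)
    (f := fun r : ℝ => η () / r) (f' := fun r => -η () / r ^ 2) measurableSet_Ioi
    (fun x hx => by
      have := ((hasDerivAt_inv (ne_of_gt hx)).const_mul (η ())).hasDerivWithinAt (s := Set.Ioi 0)
      simp only [← div_eq_mul_inv] at this
      rwa [mul_neg, ← neg_mul, ← div_eq_mul_inv] at this)
    (fun x hx y hy hxy => by
      simp only [Set.mem_Ioi] at hx hy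
      simp only at hxy
      field_simp at hxy
      exact hxy.symm)
  have h3 : (fun r : ℝ => η () / r) '' Set.Ioi 0 = Set.Ioi 0 := by
    ext t
    simp only [Set.mem_image, Set.mem_Ioi]
    constructor
    · rintro ⟨r, hr, rfl⟩
      positivity
    · intro ht
      exact ⟨η () / t, by positivity, by field_simp⟩
  rw [h3] at h2
  rw [h2]
  congr 1
  refine setLIntegral_congr_fun measurableSet_Ioi fun r hr => ?_
  have hr : 0 < r := hr
  have h4 : η () / (η () / r) = r := by field_simp
  rw [← mul_assoc, ← ENNReal.ofReal_mul (abs_nonneg _), inv_unit_mulVec (by positivity), h4,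
    igDensity]
  congr 2
  · have h5 : -(1 / 2) * (η () / r + η () * r - 2 * η ()) = -(η () / 2) * (r + 1 / r - 2) := by
      field_simp
      ring
    rw [h5, abs_div, abs_neg, abs_of_pos hη, abs_of_pos (by positivity : 0 < r ^ 2),
      Real.sqrt_div hη.le]
    have h6 := Real.sq_sqrt hr.le
    have h7 := Real.sq_sqrt hη.le
    have h8 : 0 < √r := Real.sqrt_pos.2 hr
    have h9 : 0 < √(η ()) := Real.sqrt_pos.2 hη
    field_simp
    rw [h6, h7]
    ring
  · simp [dotProduct]

section TwoByTwo

theorem opMat_finTwo {W : Matrix (Fin 2) (Fin 2) ℝ} (hW : W 1 0 = W 0 1) (x y : ℝ) :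
    opMat W ![x, y] = !![2 * x - W 0 0, -W 0 1; -W 0 1, 2 * y - W 1 1] := by
  ext i j
  fin_cases i <;> fin_cases j <;> simp [opMat, hW]

theorem posDef_finTwo {h₁ h₂ c : ℝ} :
    (!![h₁, -c; -c, h₂] : Matrix (Fin 2) (Fin 2) ℝ).PosDef ↔ 0 < h₁ ∧ 0 < h₁ * h₂ - c ^ 2 := by
  constructor
  · intro h
    have h1 : 0 < h₁ := by simpa using h.diag_pos (i := 0)
    have h2 := h.det_pos
    rw [det_fin_two_of] at h2
    exact ⟨h1, by linarith⟩
  · rintro ⟨h1, h2⟩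
    refine PosDef.of_dotProduct_mulVec_pos ?_ fun x hx => ?_
    · ext i j
      fin_cases i <;> fin_cases j <;> simp
    · simp only [star_trivial, dotProduct, mulVec, Fin.sum_univ_two, of_apply, cons_val', cons_val_zero,
        cons_val_one, cons_val_fin_one]
      have key : h₁ * (x 0 * (h₁ * x 0 + -c * x 1) + x 1 * (-c * x 0 + h₂ * x 1)) =
          (h₁ * x 0 - c * x 1) ^ 2 + (h₁ * h₂ - c ^ 2) * x 1 ^ 2 := by ring
      have hpos : 0 < (h₁ * x 0 - c * x 1) ^ 2 + (h₁ * h₂ - c ^ 2) * x 1 ^ 2 := by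
        by_cases hx1 : x 1 = 0
        · have hx0 : x 0 ≠ 0 := fun hx0 => hx <| by
            ext i
            fin_cases i
            · exact hx0
            · exact hx1
          have : h₁ * x 0 ≠ 0 := mul_ne_zero h1.ne' hx0
          have e : (h₁ * x 0 - c * 0) ^ 2 + (h₁ * h₂ - c ^ 2) * 0 ^ 2 = (h₁ * x 0) ^ 2 := by ring
          rw [hx1, e]
          positivity
        · have := sq_pos_of_ne_zero hx1
          nlinarith [mul_pos h2 this, sq_nonneg (h₁ * x 0 - c * x 1)]
      rw [← key] at hpos
      exact pos_of_mul_pos_right hpos h1.le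

theorem inv_finTwo_mulVec {h₁ h₂ c : ℝ} (h : 0 < h₁ ∧ 0 < h₁ * h₂ - c ^ 2) (η : Fin 2 → ℝ) :
    (!![h₁, -c; -c, h₂] : Matrix (Fin 2) (Fin 2) ℝ)⁻¹ *ᵥ η =
      ![(h₂ * η 0 + c * η 1) / (h₁ * h₂ - c ^ 2), (c * η 0 + h₁ * η 1) / (h₁ * h₂ - c ^ 2)] := by
  refine inv_mulVec_eq (posDef_finTwo.2 h) ?_
  obtain ⟨D, hD⟩ : ∃ D, h₁ * h₂ - c ^ 2 = D := ⟨_, rfl⟩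
  have hD0 := h.2.ne'
  rw [hD] at hD0 ⊢
  ext i
  fin_cases i <;> simp [mulVec, dotProduct, Fin.sum_univ_two] <;> field_simp <;> rw [← hD] <;> ring

theorem dens_finTwo {h₁ h₂ c : ℝ} (h : 0 < h₁ ∧ 0 < h₁ * h₂ - c ^ 2) (η : Fin 2 → ℝ) :
    dens (!![h₁, -c; -c, h₂] : Matrix (Fin 2) (Fin 2) ℝ) η =
      ENNReal.ofReal (Real.exp (-(1 / 2) * (h₁ + h₂ - 2 * c +
        (η 0 * ((h₂ * η 0 + c * η 1) / (h₁ * h₂ - c ^ 2)) +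
          η 1 * ((c * η 0 + h₁ * η 1) / (h₁ * h₂ - c ^ 2))) - 2 * (η 0 + η 1))) *
        (√(h₁ * h₂ - c ^ 2))⁻¹) := by
  unfold dens
  rw [if_pos (posDef_finTwo.2 h), inv_finTwo_mulVec h, det_fin_two_of]
  simp only [dotProduct, Fin.sum_univ_two, of_apply, cons_val', cons_val_zero,
        cons_val_one, cons_val_fin_one]
  congr 4
  · ring
  · congr 1
    ring

/-- Coordinates `(T, r)` on positive definite `2 × 2` matrices: `1 / T = ⟨η, H⁻¹ η⟩` and `r` is the
ratio of the entries of `H⁻¹ η`, for `η = (a, b)`. -/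
noncomputable def pairCoord (a b c w₀ w₁ : ℝ) (p : ℝ × ℝ) : ℝ × ℝ :=
  ((a ^ 2 * p.1 + (c + a * b * p.1) * p.2 + w₀) / 2,
    (b ^ 2 * p.1 + (c + a * b * p.1) / p.2 + w₁) / 2)

noncomputable def fderivPairCoord (a b c : ℝ) (p : ℝ × ℝ) : ℝ × ℝ →L[ℝ] ℝ × ℝ :=
  (Matrix.toLin (.finTwoProd ℝ) (.finTwoProd ℝ)
    !![(a ^ 2 + a * b * p.2) / 2, (c + a * b * p.1) / 2;
      (b ^ 2 + a * b / p.2) / 2, -((c + a * b * p.1) / p.2 ^ 2) / 2]).toContinuousLinearMap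

theorem hasFDerivAt_pairCoord (a b c w₀ w₁ : ℝ) {p : ℝ × ℝ} (hp : p.2 ≠ 0) :
    HasFDerivAt (pairCoord a b c w₀ w₁) (fderivPairCoord a b c p) p := by
  unfold fderivPairCoord pairCoord
  rw [Matrix.toLin_finTwoProd_toContinuousLinearMap]
  have hk : HasFDerivAt (fun p : ℝ × ℝ => c + a * b * p.1) _ p :=
    ((hasFDerivAt_fst (𝕜 := ℝ) (p := p)).const_mul (a * b)).const_add c
  have hi : HasFDerivAt (fun p : ℝ × ℝ => p.2⁻¹) _ p :=
    (hasDerivAt_inv hp).comp_hasFDerivAt p (hasFDerivAt_snd (𝕜 := ℝ) (p := p))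
  have h1 : HasFDerivAt (fun p : ℝ × ℝ => (a ^ 2 * p.1 + (c + a * b * p.1) * p.2 + w₀) / 2) _ p :=
    ((((hasFDerivAt_fst (𝕜 := ℝ) (p := p)).const_mul (a ^ 2)).add
      (hk.mul (hasFDerivAt_snd (𝕜 := ℝ) (p := p)))).add_const w₀).mul_const 2⁻¹
  have h2 : HasFDerivAt (fun p : ℝ × ℝ => (b ^ 2 * p.1 + (c + a * b * p.1) / p.2 + w₁) / 2) _ p :=
    ((((hasFDerivAt_fst (𝕜 := ℝ) (p := p)).const_mul (b ^ 2)).add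
      (hk.mul hi)).add_const w₁).mul_const 2⁻¹
  refine (h1.prodMk h2).congr_fderiv ?_
  ext <;> simp <;> field_simp

theorem det_fderivPairCoord (a b c : ℝ) {p : ℝ × ℝ} (hp : p.2 ≠ 0) :
    (fderivPairCoord a b c p).det =
      -(4⁻¹ * ((c + a * b * p.1) * (a + b * p.2) ^ 2 / p.2 ^ 2)) := by
  unfold fderivPairCoord
  rw [LinearMap.det_toContinuousLinearMap, LinearMap.det_toLin, Matrix.det_fin_two_of]
  field_simp
  ring

variable {a b c : ℝ}

theorem pairCoord_det (T : ℝ) {r : ℝ} (hr : r ≠ 0) :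
    (a ^ 2 * T + (c + a * b * T) * r) * (b ^ 2 * T + (c + a * b * T) / r) - c ^ 2 =
      (c + a * b * T) * T * (a + b * r) ^ 2 / r := by
  field_simp
  ring

theorem pairCoord_inv_fst (T : ℝ) {r : ℝ} (hr : r ≠ 0) :
    (b ^ 2 * T + (c + a * b * T) / r) * a + c * b = (c + a * b * T) * (a + b * r) / r := by
  field_simp
  ring

theorem pairCoord_inv_snd (T r : ℝ) :
    c * a + (a ^ 2 * T + (c + a * b * T) * r) * b = (c + a * b * T) * (a + b * r) := by
  ring

theorem injOn_pairCoord (ha : 0 ≤ a) (hb : 0 ≤ b) (hab : 0 < a + b) (hc : 0 ≤ c)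
    (hcab : 0 < c ∨ 0 < a * b) (w₀ w₁ : ℝ) :
    Set.InjOn (pairCoord a b c w₀ w₁) (Set.Ioi 0 ×ˢ Set.Ioi 0) := by
  let inv : ℝ × ℝ → ℝ × ℝ := fun q =>
    (((2 * q.1 - w₀) * (2 * q.2 - w₁) - c ^ 2) /
      (a * ((2 * q.2 - w₁) * a + c * b) + b * (c * a + (2 * q.1 - w₀) * b)),
      (c * a + (2 * q.1 - w₀) * b) / ((2 * q.2 - w₁) * a + c * b))
  refine Set.LeftInvOn.injOn (f₁' := inv) ?_
  rintro ⟨T, r⟩ ⟨hT, hr⟩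
  have hT : 0 < T := hT
  have hr : 0 < r := hr
  have hs : 0 < a + b * r := by
    rcases ha.eq_or_lt with h | h
    · have : 0 < b := by linarith
      positivity
    · positivity
  have hk : 0 < c + a * b * T := by rcases hcab with h | h <;> positivity
  have e1 : 2 * (pairCoord a b c w₀ w₁ (T, r)).1 - w₀ = a ^ 2 * T + (c + a * b * T) * r := by
    simp only [pairCoord]
    ring
  have e2 : 2 * (pairCoord a b c w₀ w₁ (T, r)).2 - w₁ = b ^ 2 * T + (c + a * b * T) / r := by
    simp only [pairCoord]
    ring
  simp only [inv]
  rw [e1, e2, pairCoord_det T hr.ne', pairCoord_inv_fst T hr.ne', pairCoord_inv_snd]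
  have e3 : a * ((c + a * b * T) * (a + b * r) / r) + b * ((c + a * b * T) * (a + b * r)) =
      (c + a * b * T) * (a + b * r) ^ 2 / r := by
    field_simp
  rw [e3]
  ext <;> simp only <;> field_simp

theorem image_pairCoord (ha : 0 ≤ a) (hb : 0 ≤ b) (hab : 0 < a + b) (hc : 0 ≤ c)
    (hcab : 0 < c ∨ 0 < a * b) (w₀ w₁ : ℝ) :
    pairCoord a b c w₀ w₁ '' (Set.Ioi 0 ×ˢ Set.Ioi 0) =
      {q | 0 < 2 * q.1 - w₀ ∧ 0 < (2 * q.1 - w₀) * (2 * q.2 - w₁) - c ^ 2} := by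
  ext q
  simp only [Set.mem_image, Set.mem_ofPred_eq, Set.mem_prod, Set.mem_Ioi]
  constructor
  · rintro ⟨⟨T, r⟩, ⟨hT, hr⟩, rfl⟩
    simp only at hT hr
    have hs : 0 < a + b * r := by
      rcases ha.eq_or_lt with h | h
      · have : 0 < b := by linarith
        positivity
      · positivity
    have hk : 0 < c + a * b * T := by rcases hcab with h | h <;> positivity
    have e1 : 2 * (pairCoord a b c w₀ w₁ (T, r)).1 - w₀ = a ^ 2 * T + (c + a * b * T) * r := by
      simp only [pairCoord]
      ring
    have e2 : 2 * (pairCoord a b c w₀ w₁ (T, r)).2 - w₁ = b ^ 2 * T + (c + a * b * T) / r := by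
      simp only [pairCoord]
      ring
    rw [e1, e2, pairCoord_det T hr.ne']
    constructor <;> positivity
  · rintro ⟨h1, hD⟩
    obtain ⟨h₁, hh1⟩ : ∃ h₁, 2 * q.1 - w₀ = h₁ := ⟨_, rfl⟩
    obtain ⟨h₂, hh2⟩ : ∃ h₂, 2 * q.2 - w₁ = h₂ := ⟨_, rfl⟩
    rw [hh1] at h1 hD
    rw [hh2] at hD
    have h2 : 0 < h₂ := by
      have : 0 < h₁ * h₂ := by nlinarith
      exact pos_of_mul_pos_right this h1.le
    have hc' : a = 0 ∨ b = 0 → 0 < c := fun h => by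
      rcases hcab with hc | h'
      · exact hc
      · rcases h with rfl | rfl <;> simp at h'
    have hM : 0 < h₂ * a + c * b := by
      rcases ha.eq_or_lt with h | h
      · have := hc' (Or.inl h.symm)
        have : 0 < b := by linarith
        positivity
      · positivity
    have hN : 0 < c * a + h₁ * b := by
      rcases hb.eq_or_lt with h | h
      · have := hc' (Or.inr h.symm)
        have : 0 < a := by linarith
        positivity
      · positivity
    have hS : 0 < a * (h₂ * a + c * b) + b * (c * a + h₁ * b) := by
      rcases ha.eq_or_lt with h | h
      · have : 0 < b := by linarith
        positivity
      · positivity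
    refine ⟨((h₁ * h₂ - c ^ 2) / (a * (h₂ * a + c * b) + b * (c * a + h₁ * b)),
      (c * a + h₁ * b) / (h₂ * a + c * b)), ⟨by simp only; positivity, by simp only; positivity⟩, ?_⟩
    have e1 : q.1 = (h₁ + w₀) / 2 := by linarith
    have e2 : q.2 = (h₂ + w₁) / 2 := by linarith
    generalize hMM : h₂ * a + c * b = M at *
    generalize hNN : c * a + h₁ * b = N at *
    generalize hSS : a * M + b * N = S at *
    have hk : c + a * b * ((h₁ * h₂ - c ^ 2) / S) = N * M / S := by
      rw [eq_div_iff hS.ne', add_mul, mul_assoc, div_mul_cancel₀ _ hS.ne', ← hSS, ← hMM, ← hNN]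
      ring
    ext
    · simp only [pairCoord]
      rw [hk, e1]
      congr 2
      field_simp
      rw [← hSS, ← hMM, ← hNN]
      ring
    · simp only [pairCoord]
      rw [hk, e2]
      congr 2
      field_simp
      rw [← hSS, ← hMM, ← hNN]
      ring

end TwoByTwo

noncomputable def pairWeight (s T : ℝ) : ℝ :=
  4⁻¹ * ((√T)⁻¹ * Real.exp (-(1 / 2) * (s ^ 2 * T + 1 / T - 2 * s)))

theorem pairWeight_nonneg (s T : ℝ) : 0 ≤ pairWeight s T := by
  unfold pairWeight
  positivity

theorem jacobian_mul_dens {a b c T r : ℝ} (hk : 0 < c + a * b * T) (hs : 0 < a + b * r)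
    (hT : 0 < T) (hr : 0 < r) {h₁ h₂ : ℝ} (e1 : h₁ = a ^ 2 * T + (c + a * b * T) * r)
    (e2 : h₂ = b ^ 2 * T + (c + a * b * T) / r) :
    4⁻¹ * ((c + a * b * T) * (a + b * r) ^ 2 / r ^ 2) *
      (Real.exp (-(1 / 2) * (h₁ + h₂ - 2 * c +
        (a * (1 / (T * (a + b * r))) + b * (r / (T * (a + b * r)))) - 2 * (a + b))) *
        (√((c + a * b * T) * T * (a + b * r) ^ 2 / r))⁻¹) =
      pairWeight (a + b) T * (igDensity (c + a * b * T) r * (a + b * r)) := by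
  have hexp : h₁ + h₂ - 2 * c +
        (a * (1 / (T * (a + b * r))) + b * (r / (T * (a + b * r)))) - 2 * (a + b) =
      ((a + b) ^ 2 * T + 1 / T - 2 * (a + b)) + (c + a * b * T) * (r + 1 / r - 2) := by
    rw [e1, e2]
    have : a * (1 / (T * (a + b * r))) + b * (r / (T * (a + b * r))) = 1 / T := by
      field_simp
    rw [this]
    field_simp
    ring
  rw [hexp, pairWeight, igDensity]
  generalize c + a * b * T = k at *
  generalize a + b * r = s at *
  rw [mul_add (-(1 / 2)), Real.exp_add, Real.sqrt_div (by positivity), Real.sqrt_mul (by positivity),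
    Real.sqrt_mul hk.le, Real.sqrt_sq hs.le]
  have h6 := Real.sq_sqrt hr.le
  have h7 := Real.sq_sqrt hk.le
  have h8 : 0 < √r := Real.sqrt_pos.2 hr
  have h9 : 0 < √k := Real.sqrt_pos.2 hk
  have h10 : 0 < √T := Real.sqrt_pos.2 hT
  have h11 : -(1 / 2) * (k * (r + 1 / r - 2)) = -(k / 2) * (r + 1 / r - 2) := by ring
  rw [h11]
  generalize Real.exp (-(k / 2) * (r + 1 / r - 2)) = E₁
  generalize Real.exp (-(1 / 2) * ((a + b) ^ 2 * T + 1 / T - 2 * (a + b))) = E₂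
  generalize √T = τ at *
  field_simp
  rw [h6, h7]
  ring

theorem schInt_finTwo {W : Matrix (Fin 2) (Fin 2) ℝ} (hW : W 1 0 = W 0 1) (hc : 0 ≤ W 0 1)
    {η : Fin 2 → ℝ} (ha : 0 ≤ η 0) (hb : 0 ≤ η 1) (hab : 0 < η 0 + η 1)
    (hcab : 0 < W 0 1 ∨ 0 < η 0 * η 1) (X : Fin 2 → ℝ) {φ : ℝ → ℝ≥0∞} (hφ : Measurable φ) :
    schInt W η X φ = ∫⁻ T in Set.Ioi 0, ENNReal.ofReal (pairWeight (η 0 + η 1) T) *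
      ∫⁻ r in Set.Ioi 0, ENNReal.ofReal (igDensity (W 0 1 + η 0 * η 1 * T) r) *
        (ENNReal.ofReal (η 0 + η 1 * r) *
          φ ((X 0 + X 1 * r) / (T * (η 0 + η 1 * r)))) := by
  have hpre := (volume_preserving_finTwoArrow ℝ).symm.lintegral_map_equiv
    (fun β => dens (opMat W β) η * φ (X ⬝ᵥ ((opMat W β)⁻¹ *ᵥ η)))
  rw [schInt, hpre]
  change ∫⁻ q : ℝ × ℝ, dens (opMat W ![q.1, q.2]) η * φ (X ⬝ᵥ ((opMat W ![q.1, q.2])⁻¹ *ᵥ η)) = _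
  simp only [opMat_finTwo hW]
  obtain ⟨c, hcc⟩ : ∃ c, c = W 0 1 := ⟨_, rfl⟩
  obtain ⟨a, haa⟩ : ∃ a, a = η 0 := ⟨_, rfl⟩
  obtain ⟨b, hbb⟩ : ∃ b, b = η 1 := ⟨_, rfl⟩
  rw [← hcc] at hc hcab ⊢
  rw [← haa] at ha hab hcab ⊢
  rw [← hbb] at hb hab hcab ⊢
  have hmeas : MeasurableSet (Set.Ioi (0 : ℝ) ×ˢ Set.Ioi (0 : ℝ)) :=
    measurableSet_Ioi.prod measurableSet_Ioi
  rw [← setLIntegral_eq_of_support_subset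
    (s := pairCoord a b c (W 0 0) (W 1 1) '' (Set.Ioi 0 ×ˢ Set.Ioi 0)),
    lintegral_image_eq_lintegral_abs_det_fderiv_mul volume hmeas
      (fun p hp => (hasFDerivAt_pairCoord a b c _ _ (ne_of_gt hp.2)).hasFDerivWithinAt)
      (injOn_pairCoord ha hb hab hc hcab _ _)]
  · have hcongr : ∀ p ∈ Set.Ioi (0 : ℝ) ×ˢ Set.Ioi (0 : ℝ),
        ENNReal.ofReal |(fderivPairCoord a b c p).det| *
          (dens !![2 * (pairCoord a b c (W 0 0) (W 1 1) p).1 - W 0 0, -c; -c,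
              2 * (pairCoord a b c (W 0 0) (W 1 1) p).2 - W 1 1] η *
            φ (X ⬝ᵥ (!![2 * (pairCoord a b c (W 0 0) (W 1 1) p).1 - W 0 0, -c; -c,
              2 * (pairCoord a b c (W 0 0) (W 1 1) p).2 - W 1 1]⁻¹ *ᵥ η))) =
        ENNReal.ofReal (pairWeight (a + b) p.1) *
          (ENNReal.ofReal (igDensity (c + a * b * p.1) p.2) *
            (ENNReal.ofReal (a + b * p.2) *
              φ ((X 0 + X 1 * p.2) / (p.1 * (a + b * p.2))))) := by
      rintro ⟨T, r⟩ ⟨hT, hr⟩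
      have hT : 0 < T := hT
      have hr : 0 < r := hr
      have hs : 0 < a + b * r := by
        rcases ha.eq_or_lt with h | h
        · have : 0 < b := by linarith
          positivity
        · positivity
      have hk : 0 < c + a * b * T := by rcases hcab with h | h <;> positivity
      obtain ⟨h₁, hh1⟩ : ∃ h₁, 2 * (pairCoord a b c (W 0 0) (W 1 1) (T, r)).1 - W 0 0 = h₁ :=
        ⟨_, rfl⟩
      obtain ⟨h₂, hh2⟩ : ∃ h₂, 2 * (pairCoord a b c (W 0 0) (W 1 1) (T, r)).2 - W 1 1 = h₂ :=
        ⟨_, rfl⟩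
      have e1 : h₁ = a ^ 2 * T + (c + a * b * T) * r := by
        rw [← hh1]
        simp only [pairCoord]
        ring
      have e2 : h₂ = b ^ 2 * T + (c + a * b * T) / r := by
        rw [← hh2]
        simp only [pairCoord]
        ring
      have eD : h₁ * h₂ - c ^ 2 = (c + a * b * T) * T * (a + b * r) ^ 2 / r := by
        rw [e1, e2, pairCoord_det T hr.ne']
      have h1 : 0 < h₁ := by
        rw [e1]
        positivity
      have hD : 0 < h₁ * h₂ - c ^ 2 := by
        rw [eD]
        positivity
      have ψ0 : (h₂ * a + c * b) / (h₁ * h₂ - c ^ 2) = 1 / (T * (a + b * r)) := by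
        rw [eD, e2, pairCoord_inv_fst T hr.ne']
        field_simp
      have ψ1 : (c * a + h₁ * b) / (h₁ * h₂ - c ^ 2) = r / (T * (a + b * r)) := by
        rw [eD, e1, pairCoord_inv_snd]
        field_simp
      rw [hh1, hh2, dens_finTwo ⟨h1, hD⟩, inv_finTwo_mulVec ⟨h1, hD⟩,
        det_fderivPairCoord a b c (p := (T, r)) hr.ne', ← haa, ← hbb, ψ0, ψ1, eD, abs_neg,
        abs_of_nonneg (by positivity), ← mul_assoc, ← ENNReal.ofReal_mul (by positivity),
        jacobian_mul_dens hk hs hT hr e1 e2, ENNReal.ofReal_mul (pairWeight_nonneg _ _),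
        ENNReal.ofReal_mul (igDensity_nonneg hr), mul_assoc, mul_assoc]
      congr 4
      simp [dotProduct, Fin.sum_univ_two]
      field_simp
    rw [setLIntegral_congr_fun hmeas hcongr, Measure.volume_eq_prod, ← Measure.prod_restrict,
      lintegral_prod]
    · refine lintegral_congr fun T => ?_
      exact lintegral_const_mul' (ENNReal.ofReal (pairWeight (a + b) T)) _ ENNReal.ofReal_ne_top
    · refine Measurable.aemeasurable ?_
      unfold pairWeight igDensity
      fun_prop
  · rw [image_pairCoord ha hb hab hc hcab]
    intro q hq
    by_contra hn
    refine hq ?_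
    simp only
    rw [dens_of_not_posDef, zero_mul]
    rwa [posDef_finTwo]

section Positivity

variable {ι : Type*} [Fintype ι] [DecidableEq ι]

theorem inv_mulVec_nonneg_of_offDiag_nonpos {H : Matrix ι ι ℝ} (hH : H.PosDef)
    (hoff : ∀ i j, i ≠ j → H i j ≤ 0) {η : ι → ℝ} (hη : ∀ i, 0 ≤ η i) (i : ι) :
    0 ≤ (H⁻¹ *ᵥ η) i := by
  set ψ := H⁻¹ *ᵥ η with hψ
  have hHψ : H *ᵥ ψ = η := mulVec_inv_mulVec hH η
  let u : ι → ℝ := fun i => max (-ψ i) 0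
  let p : ι → ℝ := fun i => max (ψ i) 0
  have hup : ψ = p - u := by
    ext j
    simp only [Pi.sub_apply, p, u]
    rcases le_total (ψ j) 0 with h | h
    · rw [max_eq_right h, max_eq_left (by linarith)]
      ring
    · rw [max_eq_left h, max_eq_right (by linarith)]
      ring
  have hu : ∀ j, 0 ≤ u j := fun j => le_max_right _ _
  have hp : ∀ j, 0 ≤ p j := fun j => le_max_right _ _
  have h1 : 0 ≤ u ⬝ᵥ (H *ᵥ ψ) := by
    rw [hHψ]
    exact Finset.sum_nonneg fun j _ => mul_nonneg (hu j) (hη j)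
  have h2 : u ⬝ᵥ (H *ᵥ p) ≤ 0 := by
    simp only [dotProduct, mulVec, Finset.mul_sum]
    refine Finset.sum_nonpos fun j _ => Finset.sum_nonpos fun k _ => ?_
    by_cases hjk : j = k
    · subst hjk
      have : u j * p j = 0 := by
        simp only [p, u]
        rcases le_total (ψ j) 0 with h | h
        · rw [max_eq_right h, mul_zero]
        · rw [max_eq_right (by linarith : -ψ j ≤ 0), zero_mul]
      rw [mul_left_comm, this, mul_zero]
    · exact mul_nonpos_of_nonneg_of_nonpos (hu j)
        (mul_nonpos_of_nonpos_of_nonneg (hoff j k hjk) (hp k))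
  rw [hup, mulVec_sub, dotProduct_sub] at h1
  have h3 : u = 0 := by
    by_contra h
    have := hH.dotProduct_mulVec_pos h
    rw [star_trivial] at this
    linarith
  have h4 : u i = 0 := congrFun h3 i
  have : -ψ i ≤ 0 := h4 ▸ le_max_left (-ψ i) 0
  linarith

theorem opMat_offDiag_nonpos {W : Matrix ι ι ℝ} (hW : ∀ i j, 0 ≤ W i j) (β : ι → ℝ) (i j : ι)
    (hij : i ≠ j) : opMat W β i j ≤ 0 := by
  simp [opMat, hij, hW i j]

theorem inv_opMat_mulVec_nonneg {W : Matrix ι ι ℝ} (hW : ∀ i j, 0 ≤ W i j) {β : ι → ℝ}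
    (hH : (opMat W β).PosDef) {η : ι → ℝ} (hη : ∀ i, 0 ≤ η i) (i : ι) :
    0 ≤ ((opMat W β)⁻¹ *ᵥ η) i :=
  inv_mulVec_nonneg_of_offDiag_nonpos hH (opMat_offDiag_nonpos hW β) hη i

theorem mulVec_nonneg {κ : Type*} {M : Matrix κ ι ℝ} (hM : ∀ i j, 0 ≤ M i j) {x : ι → ℝ}
    (hx : ∀ j, 0 ≤ x j) (i : κ) : 0 ≤ (M *ᵥ x) i :=
  Finset.sum_nonneg fun j _ => mul_nonneg (hM i j) (hx j)

theorem inv_opMat_apply_nonneg {W : Matrix ι ι ℝ} (hW : ∀ i j, 0 ≤ W i j) {β : ι → ℝ}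
    (hH : (opMat W β).PosDef) (i j : ι) : 0 ≤ (opMat W β)⁻¹ i j := by
  have := inv_opMat_mulVec_nonneg hW hH (η := Pi.single j 1)
    (fun i => by by_cases h : i = j <;> simp [h]) i
  simpa using this

end Positivity

section Comparison

theorem convexOn_comp_affine {f : ℝ → ℝ} (hf : ConvexOn ℝ (Set.Ici 0) f) {z x : ℝ} (hz : 0 ≤ z)
    (hx : 0 ≤ x) : ConvexOn ℝ (Set.Ioi 0) fun r => f (z + x * r) := by
  refine ⟨convex_Ioi 0, fun r hr s hs l m hl hm hlm => ?_⟩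
  have hr : 0 < r := hr
  have hs : 0 < s := hs
  have := hf.2 (Set.mem_Ici.2 (by positivity : 0 ≤ z + x * r))
    (Set.mem_Ici.2 (by positivity : 0 ≤ z + x * s)) hl hm hlm
  simp only [smul_eq_mul] at this ⊢
  convert this using 2
  linear_combination (-z) * hlm

theorem convexOn_perspective {f : ℝ → ℝ} (hf : ConvexOn ℝ (Set.Ici 0) f) {z x y a b T : ℝ}
    (hz : 0 ≤ z) (hx : 0 ≤ x) (hy : 0 ≤ y) (ha : 0 ≤ a) (hb : 0 ≤ b) (hab : 0 < a + b)
    (hT : 0 < T) :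
    ConvexOn ℝ (Set.Ioi 0) fun r => (a + b * r) * f (z + (x + y * r) / (T * (a + b * r))) := by
  have hpos : ∀ r, 0 < r → 0 < a + b * r := fun r hr => by
    rcases ha.eq_or_lt with h | h
    · have : 0 < b := by linarith
      positivity
    · positivity
  refine ⟨convex_Ioi 0, fun r hr s hs l m hl hm hlm => ?_⟩
  have hr : 0 < r := hr
  have hs : 0 < s := hs
  have h1 := hpos r hr
  have h2 := hpos s hs
  have e : a + b * (l * r + m * s) = l * (a + b * r) + m * (a + b * s) := by
    linear_combination (-a) * hlm
  have h3 : 0 < l * (a + b * r) + m * (a + b * s) := by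
    rcases hl.eq_or_lt with h | h
    · have : 0 < m := by linarith
      rw [← h]
      positivity
    · positivity
  have := hf.2 (Set.mem_Ici.2 (by positivity : 0 ≤ z + (x + y * r) / (T * (a + b * r))))
    (Set.mem_Ici.2 (by positivity : 0 ≤ z + (x + y * s) / (T * (a + b * s))))
    (by positivity : 0 ≤ l * (a + b * r) / (l * (a + b * r) + m * (a + b * s)))
    (by positivity : 0 ≤ m * (a + b * s) / (l * (a + b * r) + m * (a + b * s)))
    (by field_simp)
  simp only [smul_eq_mul] at this ⊢
  rw [e]
  have e2 : l * (a + b * r) / (l * (a + b * r) + m * (a + b * s)) *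
        (z + (x + y * r) / (T * (a + b * r))) +
      m * (a + b * s) / (l * (a + b * r) + m * (a + b * s)) *
        (z + (x + y * s) / (T * (a + b * s))) =
      z + (x + y * (l * r + m * s)) / (T * (l * (a + b * r) + m * (a + b * s))) := by
    have e3 : x + y * (l * r + m * s) = l * (x + y * r) + m * (x + y * s) := by
      linear_combination (-x) * hlm
    rw [e3]
    generalize x + y * r = u
    generalize x + y * s = v
    generalize a + b * r = p at *
    generalize a + b * s = q at *
    field_simp
    ring
  rw [e2] at this
  have := mul_le_mul_of_nonneg_left this h3.le
  refine this.trans_eq ?_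
  field_simp

theorem schInt_unit_anti (W W' : Matrix Unit Unit ℝ) {η η' X : Unit → ℝ} (hη : 0 < η ())
    (hηη : η () ≤ η' ()) (hX : 0 ≤ X ()) {f : ℝ → ℝ} (hf : ConvexOn ℝ (Set.Ici 0) f)
    (hf0 : ∀ r, 0 ≤ r → 0 ≤ f r) {z : ℝ} (hz : 0 ≤ z) :
    schInt W' η' X (fun y => ENNReal.ofReal (f (z + y))) ≤
      schInt W η X (fun y => ENNReal.ofReal (f (z + y))) := by
  rw [schInt_unit W X hη, schInt_unit W' X (hη.trans_le hηη)]
  refine mul_le_mul' le_rfl ?_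
  exact lintegral_igDensity_convex_anti hη hηη (convexOn_comp_affine hf hz hX)
    fun r hr => hf0 _ (by positivity)

theorem schInt_finTwo_anti {W W' : Matrix (Fin 2) (Fin 2) ℝ} (hW : W 1 0 = W 0 1)
    (hW' : W' 1 0 = W' 0 1) (hc : 0 ≤ W 0 1) (hcc : W 0 1 ≤ W' 0 1)
    {η : Fin 2 → ℝ} (ha : 0 ≤ η 0) (hb : 0 ≤ η 1) (hab : 0 < η 0 + η 1)
    (hcab : 0 < W 0 1 ∨ 0 < η 0 * η 1) {X : Fin 2 → ℝ} (hX : ∀ i, 0 ≤ X i) {f : ℝ → ℝ}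
    (hfm : Measurable f) (hf : ConvexOn ℝ (Set.Ici 0) f)
    (hf0 : ∀ r, 0 ≤ r → 0 ≤ f r) {z : ℝ} (hz : 0 ≤ z) :
    schInt W' η X (fun y => ENNReal.ofReal (f (z + y))) ≤
      schInt W η X (fun y => ENNReal.ofReal (f (z + y))) := by
  have hm : Measurable fun y => ENNReal.ofReal (f (z + y)) := by fun_prop
  rw [schInt_finTwo hW hc ha hb hab hcab X hm,
    schInt_finTwo hW' (hc.trans hcc) ha hb hab (hcab.imp_left fun h => h.trans_le hcc) X hm]
  refine setLIntegral_mono' measurableSet_Ioi fun T hT => ?_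
  have hT : 0 < T := hT
  have hk : 0 < W 0 1 + η 0 * η 1 * T := by rcases hcab with h | h <;> positivity
  have hpos : ∀ r, 0 < r → 0 < η 0 + η 1 * r := fun r hr => by
    rcases ha.eq_or_lt with h | h
    · have : 0 < η 1 := by linarith
      positivity
    · positivity
  have hX0 := hX 0
  have hX1 := hX 1
  refine mul_le_mul' le_rfl ?_
  have key := lintegral_igDensity_convex_anti hk
    (add_le_add_left hcc (η 0 * η 1 * T))
    (convexOn_perspective hf hz (hX 0) (hX 1) ha hb hab hT)
    (fun r hr => by
      have := hpos r hr
      exact mul_nonneg this.le (hf0 _ (by positivity)))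
  have hcongr : ∀ k, ∫⁻ r in Set.Ioi 0, ENNReal.ofReal (igDensity k r) *
        (ENNReal.ofReal (η 0 + η 1 * r) *
          ENNReal.ofReal (f (z + (X 0 + X 1 * r) / (T * (η 0 + η 1 * r))))) =
      ∫⁻ r in Set.Ioi 0, ENNReal.ofReal (igDensity k r) *
        ENNReal.ofReal ((η 0 + η 1 * r) *
          f (z + (X 0 + X 1 * r) / (T * (η 0 + η 1 * r)))) := fun k => by
    refine setLIntegral_congr_fun measurableSet_Ioi fun r hr => ?_
    rw [ENNReal.ofReal_mul (hpos r hr).le]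
  rw [hcongr, hcongr]
  exact key

end Comparison

/-- `H⁻¹ η` has positive entries for every positive definite `H = 2β - W`. -/
def PosGreen {ι : Type*} [Fintype ι] [DecidableEq ι] (W : Matrix ι ι ℝ) (η : ι → ℝ) : Prop :=
  ∀ β, (opMat W β).PosDef → ∀ v, 0 < ((opMat W β)⁻¹ *ᵥ η) v

section PosGreen

variable {A B : Type*} [Fintype A] [Fintype B] [DecidableEq A] [DecidableEq B]

theorem PosGreen.submatrix_equiv {ι κ : Type*} [Fintype ι] [DecidableEq ι] [Fintype κ]
    [DecidableEq κ] (e : κ ≃ ι) {W : Matrix ι ι ℝ} {η : ι → ℝ} (h : PosGreen W η) :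
    PosGreen (W.submatrix e e) (η ∘ e) := by
  intro β hβ v
  have e1 : β = (β ∘ e.symm) ∘ e := by
    ext
    simp
  rw [e1, opMat_comp_equiv] at hβ ⊢
  rw [inv_submatrix_equiv, submatrix_mulVec_equiv, Function.comp_assoc, Equiv.self_comp_symm,
    Function.comp_id]
  exact h _ ((posDef_submatrix_equiv e _).1 hβ) (e v)

theorem opMat_fromBlocks_posDef {W₁ : Matrix A A ℝ} {Q : Matrix A B ℝ} {W₂ : Matrix B B ℝ}
    {βA : A → ℝ} {βB : B → ℝ} (hP : (opMat W₁ βA).PosDef)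
    (hS : (opMat (W₂ + Qᵀ * (opMat W₁ βA)⁻¹ * Q) βB).PosDef) :
    (fromBlocks (opMat W₁ βA) (-Q) (-Qᵀ) (opMat W₂ βB)).PosDef := by
  rw [posDef_fromBlocks, opMat_sub]
  exact ⟨hP, hS⟩

theorem PosGreen.schur {W₁ : Matrix A A ℝ} {Q : Matrix A B ℝ} {W₂ : Matrix B B ℝ}
    {ηA : A → ℝ} {ηB : B → ℝ} (h : PosGreen (fromBlocks W₁ Q Qᵀ W₂) (Sum.elim ηA ηB))
    {βA : A → ℝ} (hP : (opMat W₁ βA).PosDef) :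
    PosGreen (W₂ + Qᵀ * (opMat W₁ βA)⁻¹ * Q) (ηB + Qᵀ *ᵥ ((opMat W₁ βA)⁻¹ *ᵥ ηA)) := by
  intro βB hS v
  have hH := opMat_fromBlocks_posDef hP hS
  have := h (Sum.elim βA βB) (by rwa [opMat_fromBlocks]) (Sum.inr v)
  rw [opMat_fromBlocks, inv_fromBlocks_mulVec hH, opMat_sub] at this
  exact this

theorem PosGreen.pos_of_unit {W : Matrix Unit Unit ℝ} {η : Unit → ℝ} (h : PosGreen W η) :
    0 < η () := by
  have h1 : opMat W (fun _ => (W () () + 1) / 2) = diagonal fun _ => (1 : ℝ) := by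
    rw [opMat_unit]
    congr
    ext
    ring
  have := h (fun _ => (W () () + 1) / 2) (by rw [h1]; exact posDef_unit.2 one_pos) ()
  rw [h1, inv_unit_mulVec one_pos] at this
  simpa using this

theorem PosGreen.pos_of_finTwo {W : Matrix (Fin 2) (Fin 2) ℝ} {η : Fin 2 → ℝ} (h : PosGreen W η)
    (hW : W 1 0 = W 0 1) (hc : 0 ≤ W 0 1) (ha : 0 ≤ η 0) (hb : 0 ≤ η 1) :
    0 < η 0 + η 1 ∧ (0 < W 0 1 ∨ 0 < η 0 * η 1) := by
  obtain ⟨c, hcc⟩ : ∃ c, W 0 1 = c := ⟨_, rfl⟩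
  have h1 : opMat W ![(W 0 0 + c + 1) / 2, (W 1 1 + c + 1) / 2] = !![c + 1, -c; -c, c + 1] := by
    rw [opMat_finTwo hW, hcc]
    congr 4
    · ring
    · congr 2
      ring
  rw [hcc] at hc ⊢
  have hpos : 0 < c + 1 ∧ 0 < (c + 1) * (c + 1) - c ^ 2 := ⟨by linarith, by nlinarith⟩
  have h2 := h ![(W 0 0 + c + 1) / 2, (W 1 1 + c + 1) / 2] (by rw [h1]; exact posDef_finTwo.2 hpos)
  rw [h1, inv_finTwo_mulVec hpos] at h2
  have h3 := h2 0
  have h4 := h2 1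
  simp only [cons_val_zero, cons_val_one] at h3 h4
  rw [div_pos_iff_of_pos_right hpos.2] at h3 h4
  refine ⟨?_, ?_⟩
  · by_contra hn
    have h5 : η 0 = 0 := by linarith
    have h6 : η 1 = 0 := by linarith
    simp [h5, h6] at h3
  · rcases hc.eq_or_lt with h5 | h5
    · right
      rw [← h5] at h3 h4
      exact mul_pos (by linarith) (by linarith)
    · exact Or.inl h5

theorem schur_offDiag_nonneg {W₁ : Matrix A A ℝ} {Q : Matrix A B ℝ} (hW₁ : ∀ i j, 0 ≤ W₁ i j)
    (hQ : ∀ i j, 0 ≤ Q i j) {βA : A → ℝ} (hP : (opMat W₁ βA).PosDef) (i j : B) :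
    0 ≤ (Qᵀ * (opMat W₁ βA)⁻¹ * Q) i j := by
  simp only [mul_apply, transpose_apply]
  exact Finset.sum_nonneg fun k _ => mul_nonneg (Finset.sum_nonneg fun l _ =>
    mul_nonneg (hQ _ _) (inv_opMat_apply_nonneg hW₁ hP _ _)) (hQ _ _)

theorem schur_vec_nonneg {W₁ : Matrix A A ℝ} {Q : Matrix A B ℝ} (hW₁ : ∀ i j, 0 ≤ W₁ i j)
    (hQ : ∀ i j, 0 ≤ Q i j) {βA : A → ℝ} (hP : (opMat W₁ βA).PosDef) {xA : A → ℝ} {xB : B → ℝ}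
    (hxA : ∀ i, 0 ≤ xA i) (hxB : ∀ i, 0 ≤ xB i) (i : B) :
    0 ≤ (xB + Qᵀ *ᵥ ((opMat W₁ βA)⁻¹ *ᵥ xA)) i :=
  add_nonneg (hxB i) (mulVec_nonneg (fun _ _ => hQ _ _) (inv_opMat_mulVec_nonneg hW₁ hP hxA) i)

theorem schur_transpose {W₁ : Matrix A A ℝ} {Q : Matrix A B ℝ} {βA : A → ℝ}
    (hP : (opMat W₁ βA).PosDef) (i j : B) :
    (Qᵀ * (opMat W₁ βA)⁻¹ * Q) i j = (Qᵀ * (opMat W₁ βA)⁻¹ * Q) j i := by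
  have h1 : ((opMat W₁ βA)⁻¹)ᵀ = (opMat W₁ βA)⁻¹ := by
    have := hP.inv.isHermitian.eq
    rwa [conjTranspose_eq_transpose_of_trivial] at this
  have : (Qᵀ * (opMat W₁ βA)⁻¹ * Q)ᵀ = Qᵀ * (opMat W₁ βA)⁻¹ * Q := by
    simp [transpose_mul, h1, Matrix.mul_assoc]
  exact congrFun (congrFun this j) i

end PosGreen

section Step

variable {A : Type*} [Fintype A] [DecidableEq A] {f : ℝ → ℝ}

theorem schInt_fromBlocks_unit_anti {W₁ : Matrix A A ℝ} {Q : Matrix A Unit ℝ}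
    (W₂ W₂' : Matrix Unit Unit ℝ) {ηA XA : A → ℝ} {ηB ηB' XB : Unit → ℝ}
    (hW₁ : ∀ i j, 0 ≤ W₁ i j) (hQ : ∀ i j, 0 ≤ Q i j) (hηA : ∀ i, 0 ≤ ηA i)
    (hXA : ∀ i, 0 ≤ XA i) (hXB : ∀ i, 0 ≤ XB i) (hη : ηB () ≤ ηB' ())
    (hpos : PosGreen (fromBlocks W₁ Q Qᵀ W₂) (Sum.elim ηA ηB))
    (hfm : Measurable f) (hf : ConvexOn ℝ (Set.Ici 0) f) (hf0 : ∀ r, 0 ≤ r → 0 ≤ f r)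
    {z : ℝ} (hz : 0 ≤ z) :
    schInt (fromBlocks W₁ Q Qᵀ W₂') (Sum.elim ηA ηB') (Sum.elim XA XB)
        (fun y => ENNReal.ofReal (f (z + y))) ≤
      schInt (fromBlocks W₁ Q Qᵀ W₂) (Sum.elim ηA ηB) (Sum.elim XA XB)
        (fun y => ENNReal.ofReal (f (z + y))) := by
  have hm : Measurable fun y => ENNReal.ofReal (f (z + y)) := by fun_prop
  rw [schInt_fromBlocks _ _ _ _ _ _ _ hm, schInt_fromBlocks _ _ _ _ _ _ _ hm]
  refine lintegral_mono fun βA => ?_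
  by_cases hP : (opMat W₁ βA).PosDef
  · refine mul_le_mul' le_rfl ?_
    simp only [← add_assoc z]
    refine schInt_unit_anti _ _ (hpos.schur hP).pos_of_unit ?_
      (schur_vec_nonneg hW₁ hQ hP hXA hXB ()) hf hf0 ?_
    · simpa using hη
    · exact add_nonneg hz (Finset.sum_nonneg fun i _ =>
        mul_nonneg (hXA i) (inv_opMat_mulVec_nonneg hW₁ hP hηA i))
  · simp [dens_of_not_posDef hP]

theorem schInt_fromBlocks_finTwo_anti {W₁ : Matrix A A ℝ} {Q : Matrix A (Fin 2) ℝ}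
    {W₂ W₂' : Matrix (Fin 2) (Fin 2) ℝ} {ηA XA : A → ℝ} {ηB XB : Fin 2 → ℝ}
    (hW₁ : ∀ i j, 0 ≤ W₁ i j) (hQ : ∀ i j, 0 ≤ Q i j) (hηA : ∀ i, 0 ≤ ηA i)
    (hηB : ∀ i, 0 ≤ ηB i) (hXA : ∀ i, 0 ≤ XA i) (hXB : ∀ i, 0 ≤ XB i)
    (hW : W₂ 1 0 = W₂ 0 1) (hW' : W₂' 1 0 = W₂' 0 1) (hc : 0 ≤ W₂ 0 1) (hcc : W₂ 0 1 ≤ W₂' 0 1)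
    (hpos : PosGreen (fromBlocks W₁ Q Qᵀ W₂) (Sum.elim ηA ηB))
    (hfm : Measurable f) (hf : ConvexOn ℝ (Set.Ici 0) f) (hf0 : ∀ r, 0 ≤ r → 0 ≤ f r)
    {z : ℝ} (hz : 0 ≤ z) :
    schInt (fromBlocks W₁ Q Qᵀ W₂') (Sum.elim ηA ηB) (Sum.elim XA XB)
        (fun y => ENNReal.ofReal (f (z + y))) ≤
      schInt (fromBlocks W₁ Q Qᵀ W₂) (Sum.elim ηA ηB) (Sum.elim XA XB)
        (fun y => ENNReal.ofReal (f (z + y))) := by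
  have hm : Measurable fun y => ENNReal.ofReal (f (z + y)) := by fun_prop
  rw [schInt_fromBlocks _ _ _ _ _ _ _ hm, schInt_fromBlocks _ _ _ _ _ _ _ hm]
  refine lintegral_mono fun βA => ?_
  by_cases hP : (opMat W₁ βA).PosDef
  · refine mul_le_mul' le_rfl ?_
    simp only [← add_assoc z]
    have hK := schur_offDiag_nonneg hW₁ hQ hP 0 1
    have hKs := schur_transpose (Q := Q) hP 1 0
    have hη := schur_vec_nonneg hW₁ hQ hP hηA hηB
    have hW1 : (W₂ + Qᵀ * (opMat W₁ βA)⁻¹ * Q) 1 0 = (W₂ + Qᵀ * (opMat W₁ βA)⁻¹ * Q) 0 1 := by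
      rw [Matrix.add_apply, Matrix.add_apply, hW, hKs]
    have hW2 : 0 ≤ (W₂ + Qᵀ * (opMat W₁ βA)⁻¹ * Q) 0 1 := by
      rw [Matrix.add_apply]
      exact add_nonneg hc hK
    obtain ⟨h1, h2⟩ := (hpos.schur hP).pos_of_finTwo hW1 hW2 (hη 0) (hη 1)
    refine schInt_finTwo_anti hW1 ?_ hW2 ?_ (hη 0) (hη 1) h1 h2
      (schur_vec_nonneg hW₁ hQ hP hXA hXB) hfm hf hf0 ?_
    · rw [Matrix.add_apply, Matrix.add_apply, hW', hKs]
    · rw [Matrix.add_apply, Matrix.add_apply]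
      exact add_le_add_left hcc _
    · exact add_nonneg hz (Finset.sum_nonneg fun i _ =>
        mul_nonneg (hXA i) (inv_opMat_mulVec_nonneg hW₁ hP hηA i))
  · simp [dens_of_not_posDef hP]

end Step

section General

variable {ι : Type*} [Fintype ι] [DecidableEq ι] {f : ℝ → ℝ}

theorem submatrix_eq_fromBlocks {A B : Type*} {W : Matrix ι ι ℝ} (hW : W.IsSymm)
    (e : A ⊕ B ≃ ι) :
    W.submatrix e e = fromBlocks (W.submatrix (e ∘ Sum.inl) (e ∘ Sum.inl))
      (W.submatrix (e ∘ Sum.inl) (e ∘ Sum.inr)) (W.submatrix (e ∘ Sum.inl) (e ∘ Sum.inr))ᵀ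
      (W.submatrix (e ∘ Sum.inr) (e ∘ Sum.inr)) := by
  ext (i | i) (j | j) <;> simp [hW.apply]

theorem schInt_eq_fromBlocks {A B : Type*} [Fintype A] [Fintype B] [DecidableEq A] [DecidableEq B]
    {W : Matrix ι ι ℝ} (hW : W.IsSymm) (e : A ⊕ B ≃ ι) (η X : ι → ℝ) (φ : ℝ → ℝ≥0∞) :
    schInt W η X φ = schInt (fromBlocks (W.submatrix (e ∘ Sum.inl) (e ∘ Sum.inl))
      (W.submatrix (e ∘ Sum.inl) (e ∘ Sum.inr)) (W.submatrix (e ∘ Sum.inl) (e ∘ Sum.inr))ᵀ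
      (W.submatrix (e ∘ Sum.inr) (e ∘ Sum.inr)))
      (Sum.elim (η ∘ e ∘ Sum.inl) (η ∘ e ∘ Sum.inr))
      (Sum.elim (X ∘ e ∘ Sum.inl) (X ∘ e ∘ Sum.inr)) φ := by
  rw [← submatrix_eq_fromBlocks hW, ← schInt_submatrix_equiv e, ← Function.comp_assoc,
    ← Function.comp_assoc, ← Function.comp_assoc, ← Function.comp_assoc, Sum.elim_comp_inl_inr,
    Sum.elim_comp_inl_inr]

theorem PosGreen.fromBlocks {A B : Type*} [Fintype A] [Fintype B] [DecidableEq A] [DecidableEq B]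
    {W : Matrix ι ι ℝ} (hW : W.IsSymm) (e : A ⊕ B ≃ ι) {η : ι → ℝ} (h : PosGreen W η) :
    PosGreen (Matrix.fromBlocks (W.submatrix (e ∘ Sum.inl) (e ∘ Sum.inl))
      (W.submatrix (e ∘ Sum.inl) (e ∘ Sum.inr)) (W.submatrix (e ∘ Sum.inl) (e ∘ Sum.inr))ᵀ
      (W.submatrix (e ∘ Sum.inr) (e ∘ Sum.inr)))
      (Sum.elim (η ∘ e ∘ Sum.inl) (η ∘ e ∘ Sum.inr)) := by
  rw [← submatrix_eq_fromBlocks hW, ← Function.comp_assoc, ← Function.comp_assoc,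
    Sum.elim_comp_inl_inr]
  exact h.submatrix_equiv e

theorem exists_equiv_sum_unit (k : ι) :
    ∃ e : {v // v ≠ k} ⊕ Unit ≃ ι, (∀ v, e (Sum.inl v) = v) ∧ e (Sum.inr ()) = k := by
  refine ⟨Equiv.ofBijective (Sum.elim Subtype.val fun _ => k) ⟨?_, ?_⟩, fun v => rfl, rfl⟩
  · rintro (⟨a, ha⟩ | a) (⟨b, hb⟩ | b) h
    · simpa using h
    · exact absurd h ha
    · exact absurd h.symm hb
    · rfl
  · intro v
    by_cases h : v = k
    · exact ⟨Sum.inr (), h.symm⟩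
    · exact ⟨Sum.inl ⟨v, h⟩, rfl⟩

theorem exists_equiv_sum_finTwo {j k : ι} (hjk : j ≠ k) :
    ∃ e : {v // v ≠ j ∧ v ≠ k} ⊕ Fin 2 ≃ ι, (∀ v, e (Sum.inl v) = v) ∧ e (Sum.inr 0) = j ∧
      e (Sum.inr 1) = k := by
  refine ⟨Equiv.ofBijective (Sum.elim Subtype.val ![j, k]) ⟨?_, ?_⟩, fun v => rfl, rfl, rfl⟩
  · rintro (⟨a, ha⟩ | a) (⟨b, hb⟩ | b) h
    · simpa using h
    · fin_cases b
      · exact absurd h ha.1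
      · exact absurd h ha.2
    · fin_cases a
      · exact absurd h.symm hb.1
      · exact absurd h.symm hb.2
    · fin_cases a <;> fin_cases b <;> simp_all
  · intro v
    by_cases h : v = j
    · exact ⟨Sum.inr 0, h.symm⟩
    · by_cases h' : v = k
      · exact ⟨Sum.inr 1, h'.symm⟩
      · exact ⟨Sum.inl ⟨v, h, h'⟩, rfl⟩

theorem schInt_anti_vertex {W : Matrix ι ι ℝ} (hWs : W.IsSymm) (hW : ∀ i j, 0 ≤ W i j)
    {η η' X : ι → ℝ} (hη : ∀ i, 0 ≤ η i) (hX : ∀ i, 0 ≤ X i) (k : ι) (hk : η k ≤ η' k)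
    (hne : ∀ v, v ≠ k → η' v = η v) (hpos : PosGreen W η)
    (hfm : Measurable f) (hf : ConvexOn ℝ (Set.Ici 0) f) (hf0 : ∀ r, 0 ≤ r → 0 ≤ f r)
    {z : ℝ} (hz : 0 ≤ z) :
    schInt W η' X (fun y => ENNReal.ofReal (f (z + y))) ≤
      schInt W η X (fun y => ENNReal.ofReal (f (z + y))) := by
  obtain ⟨e, he, hek⟩ := exists_equiv_sum_unit k
  rw [schInt_eq_fromBlocks hWs e, schInt_eq_fromBlocks hWs e]
  have h1 : η' ∘ e ∘ Sum.inl = η ∘ e ∘ Sum.inl := by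
    ext v
    simp only [Function.comp_apply, he]
    exact hne _ v.2
  rw [h1]
  refine schInt_fromBlocks_unit_anti _ _ (fun _ _ => hW _ _) (fun _ _ => hW _ _) (fun _ => hη _)
    (fun _ => hX _) (fun _ => hX _) ?_ (hpos.fromBlocks hWs e) hfm hf hf0 hz
  simpa [hek] using hk

theorem schInt_anti_edge {W W' : Matrix ι ι ℝ} (hWs : W.IsSymm) (hWs' : W'.IsSymm)
    (hW : ∀ i j, 0 ≤ W i j) {η X : ι → ℝ} (hη : ∀ i, 0 ≤ η i) (hX : ∀ i, 0 ≤ X i)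
    {j k : ι} (hjk : j ≠ k) (hle : W j k ≤ W' j k)
    (hne : ∀ v, v ≠ j → v ≠ k → ∀ w, W' v w = W v w) (hpos : PosGreen W η)
    (hfm : Measurable f) (hf : ConvexOn ℝ (Set.Ici 0) f) (hf0 : ∀ r, 0 ≤ r → 0 ≤ f r)
    {z : ℝ} (hz : 0 ≤ z) :
    schInt W' η X (fun y => ENNReal.ofReal (f (z + y))) ≤
      schInt W η X (fun y => ENNReal.ofReal (f (z + y))) := by
  obtain ⟨e, he, hej, hek⟩ := exists_equiv_sum_finTwo hjk
  rw [schInt_eq_fromBlocks hWs e, schInt_eq_fromBlocks hWs' e]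
  have h1 : W'.submatrix (e ∘ Sum.inl) (e ∘ Sum.inl) = W.submatrix (e ∘ Sum.inl) (e ∘ Sum.inl) := by
    ext v w
    simp only [submatrix_apply, Function.comp_apply, he]
    exact hne _ v.2.1 v.2.2 _
  have h2 : W'.submatrix (e ∘ Sum.inl) (e ∘ Sum.inr) = W.submatrix (e ∘ Sum.inl) (e ∘ Sum.inr) := by
    ext v w
    simp only [submatrix_apply, Function.comp_apply, he]
    exact hne _ v.2.1 v.2.2 _
  rw [h1, h2]
  refine schInt_fromBlocks_finTwo_anti (fun _ _ => hW _ _) (fun _ _ => hW _ _) (fun _ => hη _)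
    (fun _ => hη _) (fun _ => hX _) (fun _ => hX _) ?_ ?_ (hW _ _) ?_ (hpos.fromBlocks hWs e)
    hfm hf hf0 hz
  · simp [hej, hek, hWs.apply j k]
  · simp [hej, hek, hWs'.apply j k]
  · simpa [hej, hek] using hle

end General

theorem transpose_mulVec_unit {A : Type*} [Fintype A] (Q : Matrix A Unit ℝ) (u : A → ℝ) :
    (Qᵀ *ᵥ u) () = u ⬝ᵥ (Q *ᵥ 1) := by
  simp [mulVec, dotProduct, mul_comm]

section Restrict

variable {A : Type*} [Fintype A] [DecidableEq A]

theorem PosGreen.restrict {W₁ : Matrix A A ℝ} {Q : Matrix A Unit ℝ} {W₂ : Matrix Unit Unit ℝ}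
    {ηA : A → ℝ} {ηB : Unit → ℝ} (hW₁ : ∀ i j, 0 ≤ W₁ i j) (hQ : ∀ i j, 0 ≤ Q i j)
    (hηA : ∀ i, 0 ≤ ηA i) (hηB : ∀ i, 0 ≤ ηB i)
    (h : PosGreen (Matrix.fromBlocks W₁ Q Qᵀ W₂) (Sum.elim ηA ηB)) :
    PosGreen W₁ (ηA + Q *ᵥ 1) := by
  intro βA hP v
  obtain ⟨e, he⟩ : ∃ e, (ηB + Qᵀ *ᵥ ((opMat W₁ βA)⁻¹ *ᵥ ηA)) () = e := ⟨_, rfl⟩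
  have he0 : 0 ≤ e := he ▸ schur_vec_nonneg hW₁ hQ hP hηA hηB ()
  obtain ⟨βB, hβB⟩ : ∃ βB, opMat (W₂ + Qᵀ * (opMat W₁ βA)⁻¹ * Q) βB = diagonal fun _ => e + 1 := by
    refine ⟨fun _ => ((W₂ + Qᵀ * (opMat W₁ βA)⁻¹ * Q) () () + (e + 1)) / 2, ?_⟩
    rw [opMat_unit]
    congr
    ext
    ring
  have hS : (opMat (W₂ + Qᵀ * (opMat W₁ βA)⁻¹ * Q) βB).PosDef := by
    rw [hβB, posDef_unit]
    positivity
  have hH := opMat_fromBlocks_posDef hP hS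
  have h1 := h (Sum.elim βA βB) (by rwa [opMat_fromBlocks]) (Sum.inl v)
  rw [opMat_fromBlocks, inv_fromBlocks_mulVec hH, opMat_sub, hβB, inv_unit_mulVec (by positivity),
    he, Sum.elim_inl] at h1
  have h2 : ηA + Q *ᵥ 1 = (ηA + Q *ᵥ fun _ => e / (e + 1)) + Q *ᵥ fun _ => 1 / (e + 1) := by
    rw [add_assoc, ← mulVec_add]
    congr 2
    ext
    simp only [Pi.one_apply, Pi.add_apply]
    field_simp
  rw [h2, mulVec_add]
  exact add_pos_of_pos_of_nonneg h1 (inv_opMat_mulVec_nonneg hW₁ hP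
    (mulVec_nonneg hQ fun _ => by positivity) v)

end Restrict

theorem schInt_of_isEmpty {ι : Type*} [Fintype ι] [DecidableEq ι] [IsEmpty ι] (W : Matrix ι ι ℝ)
    (η X : ι → ℝ) (φ : ℝ → ℝ≥0∞) : schInt W η X φ = φ 0 := by
  have h : ∀ H : Matrix ι ι ℝ, dens H η = 1 := by
    intro H
    have h1 : H = 1 := Subsingleton.elim _ _
    rw [dens, if_pos (h1 ▸ PosDef.one)]
    simp
  simp [schInt, h, volume_pi]

theorem schInt_affine {ι : Type*} [Fintype ι] [DecidableEq ι] {W : Matrix ι ι ℝ} (hWs : W.IsSymm)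
    (hW : ∀ i j, 0 ≤ W i j) {η X : ι → ℝ} (hη : ∀ i, 0 ≤ η i) (hX : ∀ i, 0 ≤ X i)
    (hpos : PosGreen W η) {z : ℝ} (hz : 0 ≤ z) :
    schInt W η X (fun y => ENNReal.ofReal (z + y)) =
      (2⁻¹ * gaussMass) ^ Fintype.card ι * ENNReal.ofReal (z + ∑ i, X i) := by
  induction hn : Fintype.card ι generalizing ι z with
  | zero =>
    have := Fintype.card_eq_zero_iff.1 hn
    simp [schInt_of_isEmpty]
  | succ n ih =>
    obtain ⟨k⟩ : Nonempty ι := Fintype.card_pos_iff.1 (by omega)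
    obtain ⟨e, he, hek⟩ := exists_equiv_sum_unit k
    have hP := hpos.fromBlocks hWs e
    rw [schInt_eq_fromBlocks hWs e, schInt_fromBlocks _ _ _ _ _ _ _ (by fun_prop)]
    have hR := hP.restrict (fun _ _ => hW _ _) (fun _ _ => hW _ _) (fun _ => hη _) (fun _ => hη _)
    have hsum : z + ∑ i, X i = z + X k + ∑ v, (X ∘ e ∘ Sum.inl) v := by
      rw [← e.sum_comp, Fintype.sum_sum_type]
      simp [hek]
      ring
    have hcard : Fintype.card {v // v ≠ k} = n := by
      rw [Fintype.card_subtype_compl, Fintype.card_subtype_eq]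
      omega
    have hIH := ih (W := W.submatrix (e ∘ Sum.inl) (e ∘ Sum.inl)) (hWs.submatrix _)
      (fun _ _ => hW _ _)
      (η := η ∘ e ∘ Sum.inl + W.submatrix (e ∘ Sum.inl) (e ∘ Sum.inr) *ᵥ 1)
      (fun v => add_nonneg (hη _) (mulVec_nonneg (fun _ _ => hW _ _)
      (fun _ => zero_le_one) v)) (X := X ∘ e ∘ Sum.inl) (fun _ => hX _) hR
      (add_nonneg hz (hX k)) hcard
    rw [hsum, pow_succ', mul_assoc, ← hIH]
    rw [schInt, ← lintegral_const_mul' _ _ (ENNReal.mul_ne_top (by simp) gaussMass_ne_top)]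
    refine lintegral_congr fun βA => ?_
    by_cases hA : (opMat (W.submatrix (e ∘ Sum.inl) (e ∘ Sum.inl)) βA).PosDef
    · rw [mul_left_comm]
      congr 1
      have hη1 := (hP.schur hA).pos_of_unit
      have hX1 := schur_vec_nonneg (W₁ := W.submatrix (e ∘ Sum.inl) (e ∘ Sum.inl))
        (Q := W.submatrix (e ∘ Sum.inl) (e ∘ Sum.inr))
        (fun _ _ => hW _ _) (fun _ _ => hW _ _) hA (xA := X ∘ e ∘ Sum.inl)
        (xB := X ∘ e ∘ Sum.inr) (fun _ => hX _) (fun _ => hX _) ()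
      have h0 : 0 ≤ z + (X ∘ e ∘ Sum.inl) ⬝ᵥ
          ((opMat (W.submatrix (e ∘ Sum.inl) (e ∘ Sum.inl)) βA)⁻¹ *ᵥ (η ∘ e ∘ Sum.inl)) :=
        add_nonneg hz (Finset.sum_nonneg fun v _ => mul_nonneg (hX _)
          (inv_opMat_mulVec_nonneg (fun _ _ => hW _ _) hA (fun _ => hη _) v))
      rw [schInt_unit _ _ hη1]
      simp only [← add_assoc z]
      rw [lintegral_igDensity_affine hη1 h0 hX1, mul_assoc]
      congr 3
      rw [mulVec_add, dotProduct_add, dotProduct_inv_symm hA _ (_ *ᵥ 1), ← transpose_mulVec_unit,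
        Pi.add_apply, Function.comp_apply, Function.comp_apply, hek]
      ring
    · simp [dens_of_not_posDef hA]

/-- The total mass of `ν^{0,0}` on `ℝ^1`, up to normalisation. -/
noncomputable def rootMass : ℝ≥0∞ :=
  2⁻¹ * ∫⁻ t in Set.Ioi (0 : ℝ), ENNReal.ofReal (Real.exp (-(1 / 2) * t) * (√t)⁻¹)

theorem rootMass_ne_top : rootMass ≠ ∞ := by
  refine ENNReal.mul_ne_top (by simp) (ne_of_lt ?_)
  have h := Real.GammaIntegral_convergent (s := 1 / 2) (by norm_num)
  have h2 : IntegrableOn (fun t : ℝ => Real.exp (-(1 / 2) * t) * (√t)⁻¹) (Set.Ioi 0) := by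
    have h3 := (integrableOn_Ioi_comp_mul_left_iff
      (fun x : ℝ => Real.exp (-x) * x ^ ((1 / 2 : ℝ) - 1)) 0 (a := 1 / 2) (by norm_num)).2
      (by simpa using h)
    refine IntegrableOn.congr_fun (h3.const_mul (√(1 / 2))) (fun t ht => ?_) measurableSet_Ioi
    have ht : 0 < t := ht
    have h4 : (1 / 2 * t : ℝ) ^ ((1 / 2 : ℝ) - 1) = (√(1 / 2))⁻¹ * (√t)⁻¹ := by
      rw [Real.mul_rpow (by norm_num) ht.le, Real.sqrt_eq_rpow, Real.sqrt_eq_rpow,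
        ← Real.rpow_neg (by norm_num), ← Real.rpow_neg ht.le]
      norm_num
    have h5 : (0 : ℝ) < √(1 / 2) := by positivity
    rw [h4, neg_mul]
    field_simp
  exact h2.lintegral_lt_top

theorem lintegral_dens_zero_unit (W : Matrix Unit Unit ℝ) :
    ∫⁻ β : Unit → ℝ, dens (opMat W β) 0 = rootMass := by
  have := lintegral_dens_unit W 0 fun _ => 1
  simpa [rootMass] using this

section Root

variable {ι : Type*} [Fintype ι] [DecidableEq ι]

theorem measurable_ratio (W : Matrix ι ι ℝ) (u X : ι → ℝ) :
    Measurable fun β => (u ⬝ᵥ ((opMat W β)⁻¹ *ᵥ X)) / (u ⬝ᵥ ((opMat W β)⁻¹ *ᵥ u)) :=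
  (measurable_dotProduct_inv W X u).div (measurable_dotProduct_inv W u u)

theorem ratio_fromBlocks {A : Type*} [Fintype A] [DecidableEq A] {W₁ : Matrix A A ℝ}
    {Q : Matrix A Unit ℝ} {W₂ : Matrix Unit Unit ℝ} {βA : A → ℝ} {βB : Unit → ℝ}
    (hP : (opMat W₁ βA).PosDef)
    (hS : (opMat (W₂ + Qᵀ * (opMat W₁ βA)⁻¹ * Q) βB).PosDef) (XA : A → ℝ) (XB : Unit → ℝ) :
    (Sum.elim (0 : A → ℝ) (1 : Unit → ℝ) ⬝ᵥ
        ((opMat (fromBlocks W₁ Q Qᵀ W₂) (Sum.elim βA βB))⁻¹ *ᵥ Sum.elim XA XB)) /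
      (Sum.elim (0 : A → ℝ) (1 : Unit → ℝ) ⬝ᵥ
        ((opMat (fromBlocks W₁ Q Qᵀ W₂) (Sum.elim βA βB))⁻¹ *ᵥ Sum.elim (0 : A → ℝ) (1 : Unit → ℝ))) =
      XB () + XA ⬝ᵥ ((opMat W₁ βA)⁻¹ *ᵥ (Q *ᵥ 1)) := by
  have hH := opMat_fromBlocks_posDef hP hS
  rw [opMat_fromBlocks, dotProduct_inv_fromBlocks hH, dotProduct_inv_fromBlocks hH, opMat_sub,
    dotProduct_inv_symm hP XA]
  rw [opMat_unit] at hS ⊢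
  rw [posDef_unit] at hS
  rw [inv_unit_mulVec hS, inv_unit_mulVec hS]
  simp only [mulVec_zero, dotProduct_zero, zero_dotProduct, zero_add, add_zero, Pi.add_apply,
    Pi.zero_apply,
    transpose_mulVec_unit, Pi.one_apply]
  simp only [dotProduct, Finset.univ_unique, PUnit.default_eq_unit, Finset.sum_singleton,
    Pi.one_apply, one_mul]
  field_simp

theorem lintegral_dens_ratio {W : Matrix ι ι ℝ} (hWs : W.IsSymm) (i : ι) (X : ι → ℝ)
    {φ : ℝ → ℝ≥0∞} (hφ : Measurable φ) :
    ∫⁻ β, dens (opMat W β) 0 *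
        φ ((∑ j, X j * (opMat W β)⁻¹ i j) / (opMat W β)⁻¹ i i) =
      rootMass * schInt (W.submatrix (Subtype.val : {v // v ≠ i} → ι) Subtype.val)
        (fun v => W v i) (fun v => X v) (fun y => φ (X i + y)) := by
  obtain ⟨e, he, hei⟩ := exists_equiv_sum_unit i
  obtain ⟨u, hu'⟩ : ∃ u : {v // v ≠ i} ⊕ Unit → ℝ,
      u = Sum.elim (0 : {v // v ≠ i} → ℝ) (1 : Unit → ℝ) := ⟨_, rfl⟩
  have hu : (Pi.single i 1 : ι → ℝ) ∘ e = u := by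
    rw [hu']
    ext (v | v)
    · simp [he, v.2]
    · simp [hei]
  have hXe : X ∘ e = Sum.elim (X ∘ e ∘ Sum.inl) (X ∘ e ∘ Sum.inr) := by
    rw [← Function.comp_assoc, ← Function.comp_assoc, Sum.elim_comp_inl_inr]
  have h1 : W.submatrix (e ∘ Sum.inl) (e ∘ Sum.inl) =
      W.submatrix (Subtype.val : {v // v ≠ i} → ι) Subtype.val := by
    ext
    simp [he]
  have h2 : W.submatrix (e ∘ Sum.inl) (e ∘ Sum.inr) *ᵥ 1 = fun v : {v // v ≠ i} => W v i := by
    ext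
    simp [mulVec, dotProduct, he, hei]
  have h3 : X ∘ e ∘ Sum.inl = fun v : {v // v ≠ i} => X v := by
    ext
    simp [he]
  have hF : ∀ β, dens (opMat W β) 0 *
        φ ((∑ j, X j * (opMat W β)⁻¹ i j) / (opMat W β)⁻¹ i i) =
      dens (opMat (W.submatrix e e) (β ∘ e)) 0 *
        φ ((u ⬝ᵥ ((opMat (W.submatrix e e) (β ∘ e))⁻¹ *ᵥ (X ∘ e))) /
          (u ⬝ᵥ ((opMat (W.submatrix e e) (β ∘ e))⁻¹ *ᵥ u))) := by
    intro β
    rw [← hu, opMat_comp_equiv, dotProduct_inv_submatrix_equiv, dotProduct_inv_submatrix_equiv,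
      show (0 : {v // v ≠ i} ⊕ Unit → ℝ) = (0 : ι → ℝ) ∘ e from rfl, dens_submatrix_equiv,
      single_one_dotProduct, single_one_dotProduct, mulVec_single_one, col_apply]
    simp only [mulVec, dotProduct, mul_comm]
  simp only [hF]
  have hm := (measurable_dens (W.submatrix e e) 0).mul
    (hφ.comp (measurable_ratio (W.submatrix e e) u (X ∘ e)))
  simp only [Pi.mul_def, Function.comp_def φ] at hm
  rw [lintegral_comp_equiv e fun γ => dens (opMat (W.submatrix e e) γ) 0 *
        φ ((u ⬝ᵥ ((opMat (W.submatrix e e) γ)⁻¹ *ᵥ (X ∘ e))) /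
          (u ⬝ᵥ ((opMat (W.submatrix e e) γ)⁻¹ *ᵥ u))),
    lintegral_sum_pi hm, schInt, hu',
    ← lintegral_const_mul' _ _ rootMass_ne_top, submatrix_eq_fromBlocks hWs, hXe, h1]
  refine lintegral_congr fun βA => ?_
  have hd : ∀ βB, dens (opMat (fromBlocks (W.submatrix (Subtype.val : {v // v ≠ i} → ι)
      Subtype.val) (W.submatrix (e ∘ Sum.inl) (e ∘ Sum.inr))
      (W.submatrix (e ∘ Sum.inl) (e ∘ Sum.inr))ᵀ (W.submatrix (e ∘ Sum.inr) (e ∘ Sum.inr)))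
      (Sum.elim βA βB)) 0 = dens (opMat (W.submatrix (Subtype.val : {v // v ≠ i} → ι)
      Subtype.val) βA) (fun v => W v i) * dens (opMat (W.submatrix (e ∘ Sum.inr) (e ∘ Sum.inr) +
        (W.submatrix (e ∘ Sum.inl) (e ∘ Sum.inr))ᵀ * (opMat (W.submatrix
        (Subtype.val : {v // v ≠ i} → ι) Subtype.val) βA)⁻¹ *
        (W.submatrix (e ∘ Sum.inl) (e ∘ Sum.inr))) βB) 0 := by
    intro βB
    rw [← Sum.elim_zero_zero, opMat_fromBlocks, dens_fromBlocks, opMat_sub, zero_add, zero_add,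
      mulVec_zero, mulVec_zero, h2]
  simp only [hd]
  by_cases hP : (opMat (W.submatrix (Subtype.val : {v // v ≠ i} → ι) Subtype.val) βA).PosDef
  swap
  · simp [dens_of_not_posDef hP]
  rw [← lintegral_dens_zero_unit (W.submatrix (e ∘ Sum.inr) (e ∘ Sum.inr) +
        (W.submatrix (e ∘ Sum.inl) (e ∘ Sum.inr))ᵀ * (opMat (W.submatrix
        (Subtype.val : {v // v ≠ i} → ι) Subtype.val) βA)⁻¹ *
        (W.submatrix (e ∘ Sum.inl) (e ∘ Sum.inr))), ← lintegral_mul_const _ (measurable_dens _ _)]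
  refine lintegral_congr fun βB => ?_
  by_cases hS : (opMat (W.submatrix (e ∘ Sum.inr) (e ∘ Sum.inr) +
        (W.submatrix (e ∘ Sum.inl) (e ∘ Sum.inr))ᵀ * (opMat (W.submatrix
        (Subtype.val : {v // v ≠ i} → ι) Subtype.val) βA)⁻¹ *
        (W.submatrix (e ∘ Sum.inl) (e ∘ Sum.inr))) βB).PosDef
  · rw [ratio_fromBlocks hP hS, h2, h3, Function.comp_apply, Function.comp_apply, hei]
    ring
  · rw [dens_of_not_posDef hS, mul_zero, zero_mul, zero_mul]

theorem eq_zero_of_inv_opMat_mulVec_eq_zero {W : Matrix ι ι ℝ} (hW : ∀ i j, 0 ≤ W i j) {β : ι → ℝ}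
    (hP : (opMat W β).PosDef) {η : ι → ℝ} (hη : ∀ i, 0 ≤ η i) {a : ι}
    (ha : ((opMat W β)⁻¹ *ᵥ η) a = 0) :
    η a = 0 ∧ ∀ b, W a b * ((opMat W β)⁻¹ *ᵥ η) b = 0 := by
  have hnn := inv_opMat_mulVec_nonneg hW hP hη
  have h1 := congrFun (mulVec_inv_mulVec hP η) a
  obtain ⟨ψ, hψ⟩ : ∃ ψ, (opMat W β)⁻¹ *ᵥ η = ψ := ⟨_, rfl⟩
  rw [hψ] at ha hnn h1 ⊢
  have h2 : 0 ≤ ∑ b, W a b * ψ b := Finset.sum_nonneg fun b _ => mul_nonneg (hW _ _) (hnn b)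
  rw [opMat, sub_mulVec, Pi.sub_apply, mulVec_diagonal, ha, mul_zero, zero_sub] at h1
  simp only [mulVec, dotProduct] at h1
  have h3 := hη a
  refine ⟨by linarith, fun b => ?_⟩
  exact (Finset.sum_eq_zero_iff_of_nonneg fun b _ => mul_nonneg (hW _ _) (hnn b)).1
    (le_antisymm (by linarith) h2) b (Finset.mem_univ _)

theorem posGreen_of_connected {W : Matrix ι ι ℝ} (hW : ∀ i j, 0 ≤ W i j)
    {i : ι} (hconn : ∀ j, Relation.ReflTransGen (fun a b => W a b ≠ 0) j i) :
    PosGreen (W.submatrix (Subtype.val : {v // v ≠ i} → ι) Subtype.val) (fun v => W v i) := by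
  intro β hP v
  have hW1 : ∀ a b : {v // v ≠ i}, 0 ≤ W.submatrix (Subtype.val : {v // v ≠ i} → ι) Subtype.val a b :=
    fun a b => hW _ _
  have hη : ∀ v : {v // v ≠ i}, 0 ≤ W v i := fun v => hW _ _
  have hnn := inv_opMat_mulVec_nonneg hW1 hP hη
  have hrow := fun a => eq_zero_of_inv_opMat_mulVec_eq_zero hW1 hP hη (a := a)
  obtain ⟨ψ, hψ⟩ : ∃ ψ, (opMat (W.submatrix (Subtype.val : {v // v ≠ i} → ι) Subtype.val) β)⁻¹ *ᵥ
    (fun v : {v // v ≠ i} => W v i) = ψ := ⟨_, rfl⟩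
  rw [hψ] at hnn hrow ⊢
  have key : ∀ j, Relation.ReflTransGen (fun a b => W a b ≠ 0) j i →
      ∀ h : j ≠ i, 0 < ψ ⟨j, h⟩ := by
    intro j hj
    induction hj using Relation.ReflTransGen.head_induction_on with
    | refl => exact fun h => absurd rfl h
    | @head a b hab _ ih =>
      intro ha
      refine (hnn _).lt_of_ne fun h0 => ?_
      obtain ⟨h1, h2⟩ := hrow ⟨a, ha⟩ h0.symm
      by_cases hb : b = i
      · exact hab (hb ▸ h1)
      · exact (mul_ne_zero hab (ih hb).ne') (h2 ⟨b, hb⟩)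
  exact key v (hconn v) v.2

end Root

section

variable {ι : Type*} [Fintype ι] [DecidableEq ι]

/-- The integral of `φ(Σ_j X_j G(i,j) / G(i,i))`, with the factor of the root `i` integrated out. -/
noncomputable def rootInt (W : Matrix ι ι ℝ) (i : ι) (X : ι → ℝ) (φ : ℝ → ℝ≥0∞) : ℝ≥0∞ :=
  schInt (W.submatrix (Subtype.val : {v // v ≠ i} → ι) Subtype.val) (fun v => W v i)
    (fun v => X v) (fun y => φ (X i + y))

section Monotone

variable {f : ℝ → ℝ} {X : ι → ℝ}

theorem rootInt_anti_edge {W W' : Matrix ι ι ℝ} (hWs : W.IsSymm) (hWs' : W'.IsSymm)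
    (hW : ∀ i j, 0 ≤ W i j) (hle : ∀ i j, W i j ≤ W' i j) {i : ι}
    (hconn : ∀ j, Relation.ReflTransGen (fun a b => W a b ≠ 0) j i) {j k : ι} (hjk : j ≠ k)
    (hne : ∀ a b, s(a, b) ≠ s(j, k) → W' a b = W a b) (hX : ∀ i, 0 ≤ X i)
    (hfm : Measurable f) (hf : ConvexOn ℝ (Set.Ici 0) f) (hf0 : ∀ r, 0 ≤ r → 0 ≤ f r) :
    rootInt W' i X (fun y => ENNReal.ofReal (f y)) ≤
      rootInt W i X (fun y => ENNReal.ofReal (f y)) := by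
  have hpos := posGreen_of_connected hW hconn
  have vertex : ∀ k, k ≠ i → (∀ a b, s(a, b) ≠ s(i, k) → W' a b = W a b) →
      rootInt W' i X (fun y => ENNReal.ofReal (f y)) ≤
        rootInt W i X (fun y => ENNReal.ofReal (f y)) := by
    intro k hk hne
    have h1 : W'.submatrix (Subtype.val : {v // v ≠ i} → ι) (Subtype.val : {v // v ≠ i} → ι) =
        W.submatrix (Subtype.val : {v // v ≠ i} → ι) (Subtype.val : {v // v ≠ i} → ι) := by
      ext a b
      refine hne _ _ fun h => ?_
      rcases Sym2.eq_iff.1 h with h | h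
      · exact a.2 h.1
      · exact b.2 h.2
    rw [rootInt, rootInt, h1]
    refine schInt_anti_vertex (hWs.submatrix _) (fun _ _ => hW _ _) (fun _ => hW _ _)
      (fun _ => hX _) (⟨k, hk⟩ : {v // v ≠ i}) (hle _ _)
      (fun v hv => hne _ _ fun h => ?_) hpos hfm hf hf0 (hX i)
    rcases Sym2.eq_iff.1 h with h | h
    · exact v.2 h.1
    · exact hv (Subtype.ext h.1)
  by_cases hj : j = i
  · subst hj
    exact vertex k hjk.symm hne
  by_cases hk : k = i
  · subst hk
    exact vertex j hjk fun a b h => hne a b (by rwa [Sym2.eq_swap (a := j)])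
  have h1 : (fun v : {v // v ≠ i} => W' v i) = fun v : {v // v ≠ i} => W v i := by
    ext v
    refine hne _ _ fun h => ?_
    rcases Sym2.eq_iff.1 h with h | h
    · exact hk h.2.symm
    · exact hj h.2.symm
  rw [rootInt, rootInt, h1]
  refine schInt_anti_edge (hWs.submatrix _) (hWs'.submatrix _) (fun _ _ => hW _ _)
    (fun _ => hW _ _) (fun _ => hX _) (j := ⟨j, hj⟩) (k := ⟨k, hk⟩)
    (fun h => hjk (congrArg Subtype.val h)) (hle _ _) (fun v hvj hvk w => hne _ _ fun h => ?_)
    hpos hfm hf hf0 (hX i)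
  rcases Sym2.eq_iff.1 h with h | h
  · exact hvj (Subtype.ext h.1)
  · exact hvk (Subtype.ext h.1)

theorem rootInt_anti {W W' : Matrix ι ι ℝ} (hWs : W.IsSymm) (hWs' : W'.IsSymm)
    (hWd : ∀ i, W' i i = W i i) (hW : ∀ i j, 0 ≤ W i j) (hle : ∀ i j, W i j ≤ W' i j) {i : ι}
    (hconn : ∀ j, Relation.ReflTransGen (fun a b => W a b ≠ 0) j i) (hX : ∀ i, 0 ≤ X i)
    (hfm : Measurable f) (hf : ConvexOn ℝ (Set.Ici 0) f) (hf0 : ∀ r, 0 ≤ r → 0 ≤ f r) :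
    rootInt W' i X (fun y => ENNReal.ofReal (f y)) ≤
      rootInt W i X (fun y => ENNReal.ofReal (f y)) := by
  let M : Finset (Sym2 ι) → Matrix ι ι ℝ := fun T a b => if s(a, b) ∈ T then W' a b else W a b
  have hM : ∀ T a b, M T a b = if s(a, b) ∈ T then W' a b else W a b := fun T a b => rfl
  have hMs : ∀ T, (M T).IsSymm := fun T => by
    ext a b
    rw [transpose_apply, hM, hM, Sym2.eq_swap, hWs.apply, hWs'.apply]
  have hMW : ∀ T a b, W a b ≤ M T a b := fun T a b => by
    rw [hM]
    split_ifs
    exacts [hle _ _, le_rfl]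
  have key : ∀ T, rootInt (M T) i X (fun y => ENNReal.ofReal (f y)) ≤
      rootInt W i X (fun y => ENNReal.ofReal (f y)) := by
    intro T
    induction T using Finset.induction_on with
    | empty =>
      refine le_of_eq (congrArg (rootInt · i X _) ?_)
      ext a b
      simp [hM]
    | insert d T hd ih =>
      refine le_trans ?_ ih
      induction d using Sym2.ind with
      | _ j k =>
        have hne : ∀ a b, s(a, b) ≠ s(j, k) → M (insert s(j, k) T) a b = M T a b := by
          intro a b h
          simp [hM, Finset.mem_insert, h]
        by_cases hjk : j = k
        · refine le_of_eq (congrArg (rootInt · i X _) ?_)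
          ext a b
          by_cases h : s(a, b) = s(j, k)
          · have hab : a = b := by
              rcases Sym2.eq_iff.1 h with h | h <;> rw [h.1, h.2, hjk]
            simp [hM, hab, hWd]
          · exact hne a b h
        · refine rootInt_anti_edge (hMs _) (hMs _) (fun a b => (hW a b).trans (hMW T a b)) ?_
            (fun v => (hconn v).lift id fun a b hab => ?_) hjk hne hX hfm hf hf0
          · intro a b
            simp only [hM, Finset.mem_insert]
            split_ifs with h1 h2 h2
            · exact le_rfl
            · exact absurd (Or.inr h1) h2
            · exact hle _ _
            · exact le_rfl
          · exact (((hW a b).lt_of_ne' hab).trans_le (hMW T a b)).ne'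
  have := key Finset.univ
  rwa [show M Finset.univ = W' by ext a b; simp [hM]] at this

theorem rootInt_affine {W : Matrix ι ι ℝ} (hWs : W.IsSymm) (hW : ∀ i j, 0 ≤ W i j) {i : ι}
    (hconn : ∀ j, Relation.ReflTransGen (fun a b => W a b ≠ 0) j i) (hX : ∀ i, 0 ≤ X i)
    {z : ℝ} (hz : 0 ≤ z) :
    rootInt W i X (fun y => ENNReal.ofReal (z + y)) =
      (2⁻¹ * gaussMass) ^ Fintype.card {v // v ≠ i} *
        ENNReal.ofReal (z + X i + ∑ v : {v // v ≠ i}, X v) := by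
  simp only [rootInt, ← add_assoc z]
  exact schInt_affine (hWs.submatrix _) (fun _ _ => hW _ _) (fun _ => hW _ _) (fun _ => hX _)
    (posGreen_of_connected hW hconn) (add_nonneg hz (hX i))

end Monotone

end

theorem exists_affine_minorant {f : ℝ → ℝ} (hf : ConvexOn ℝ (Set.Ici 0) f) :
    ∃ a b : ℝ, ∀ y, 0 ≤ y → a + b * y ≤ f y := by
  refine ⟨f 1 - (f 1 - f 0) - (f 2 - 2 * f 1 + f 0), f 1 - f 0, fun y hy => ?_⟩
  have h012 := hf.slope_mono_adjacent (x := 0) (y := 1) (z := 2) (by simp) (by simp) (by norm_num)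
    (by norm_num)
  norm_num at h012
  rcases lt_trichotomy y 1 with h | h | h
  · have := hf.slope_mono_adjacent (x := y) (y := 1) (z := 2) hy (by simp) h (by norm_num)
    norm_num at this
    rw [div_le_iff₀ (by linarith)] at this
    nlinarith
  · subst h
    linarith
  · have := hf.slope_mono_adjacent (x := 0) (y := 1) (z := y) (by simp) hy (by norm_num) h
    rw [sub_zero, div_one, le_div_iff₀ (by linarith)] at this
    linarith

theorem measurable_comp_max_zero {f : ℝ → ℝ} (hf : ConvexOn ℝ (Set.Ici 0) f) :
    Measurable fun y => f (max y 0) := by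
  have hc : ContinuousOn f (Set.Ioi 0) := by
    have := hf.continuousOn_interior
    rwa [interior_Ici] at this
  have h : (fun y => f (max y 0)) = (Set.Ioi (0 : ℝ)).piecewise f fun _ => f 0 := by
    ext y
    by_cases hy : 0 < y
    · rw [Set.piecewise_eq_of_mem _ _ _ (Set.mem_Ioi.2 hy), max_eq_left hy.le]
    · rw [Set.piecewise_eq_of_notMem _ _ _ (by simpa using hy), max_eq_right (not_lt.1 hy)]
  rw [h]
  exact hc.measurable_piecewise continuousOn_const measurableSet_Ioi

theorem integral_convexOn_le {ρ ρ' : Measure ℝ} {f : ℝ → ℝ} (hf : ConvexOn ℝ (Set.Ici 0) f)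
    (hρ : ∀ᵐ y ∂ρ, 0 ≤ y) (hρ' : ∀ᵐ y ∂ρ', 0 ≤ y) (hint : Integrable f ρ)
    (hint' : Integrable f ρ')
    (hlin : ∀ z, 0 ≤ z → ∫⁻ y, ENNReal.ofReal (z + y) ∂ρ' = ∫⁻ y, ENNReal.ofReal (z + y) ∂ρ)
    (hfin : ∀ z, 0 ≤ z → ∫⁻ y, ENNReal.ofReal (z + y) ∂ρ ≠ ⊤)
    (hconv : ∀ g : ℝ → ℝ, Measurable g → ConvexOn ℝ (Set.Ici 0) g → (∀ r, 0 ≤ r → 0 ≤ g r) →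
      ∫⁻ y, ENNReal.ofReal (g y) ∂ρ' ≤ ∫⁻ y, ENNReal.ofReal (g y) ∂ρ) :
    ∫ y, f y ∂ρ' ≤ ∫ y, f y ∂ρ := by
  have hZ : ∀ {σ : Measure ℝ}, (∀ᵐ y ∂σ, 0 ≤ y) →
      (∀ z, 0 ≤ z → ∫⁻ y, ENNReal.ofReal (z + y) ∂σ ≠ ⊤) → ∀ z, 0 ≤ z →
      Integrable (fun y => z + y) σ := by
    intro σ h1 h2 z hz
    refine ⟨by fun_prop, ?_⟩
    rw [hasFiniteIntegral_iff_ofReal (h1.mono fun y hy => add_nonneg hz hy)]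
    exact (h2 z hz).lt_top
  have hfin' : ∀ z, 0 ≤ z → ∫⁻ y, ENNReal.ofReal (z + y) ∂ρ' ≠ ⊤ := fun z hz => by
    rw [hlin z hz]
    exact hfin z hz
  have hintZ : ∀ z, 0 ≤ z → ∫ y, (z + y) ∂ρ' = ∫ y, (z + y) ∂ρ := by
    intro z hz
    rw [integral_eq_lintegral_of_nonneg_ae (hρ.mono fun y hy => add_nonneg hz hy) (by fun_prop),
      integral_eq_lintegral_of_nonneg_ae (hρ'.mono fun y hy => add_nonneg hz hy) (by fun_prop),
      hlin z hz]
  obtain ⟨a, b, hab⟩ := exists_affine_minorant hf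
  have hlineq : ∀ y : ℝ, a + b * y = a * (1 + y) + (b - a) * (0 + y) := fun y => by ring
  have hI : Integrable (fun y => a + b * y) ρ := by
    simp only [hlineq]
    exact ((hZ hρ hfin 1 zero_le_one).const_mul a).add ((hZ hρ hfin 0 le_rfl).const_mul (b - a))
  have hI' : Integrable (fun y => a + b * y) ρ' := by
    simp only [hlineq]
    exact ((hZ hρ' hfin' 1 zero_le_one).const_mul a).add ((hZ hρ' hfin' 0 le_rfl).const_mul (b - a))
  have hIeq : ∫ y, (a + b * y) ∂ρ' = ∫ y, (a + b * y) ∂ρ := by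
    simp only [hlineq]
    rw [integral_add ((hZ hρ hfin 1 zero_le_one).const_mul a)
      ((hZ hρ hfin 0 le_rfl).const_mul (b - a)), integral_add
      ((hZ hρ' hfin' 1 zero_le_one).const_mul a) ((hZ hρ' hfin' 0 le_rfl).const_mul (b - a)),
      integral_const_mul, integral_const_mul, integral_const_mul, integral_const_mul,
      hintZ 1 zero_le_one, hintZ 0 le_rfl]
  let g : ℝ → ℝ := fun y => f (max y 0) - (a + b * y)
  have hgm : Measurable g := (measurable_comp_max_zero hf).sub (by fun_prop)
  have hgf : ∀ y, 0 ≤ y → g y = f y - (a + b * y) := fun y hy => by simp only [g, max_eq_left hy]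
  have hg0 : ∀ y, 0 ≤ y → 0 ≤ g y := fun y hy => by
    rw [hgf y hy]
    linarith [hab y hy]
  have hgc : ConvexOn ℝ (Set.Ici 0) g := by
    refine ⟨convex_Ici 0, fun x hx y hy l m hl hm hlm => ?_⟩
    have h1 := hf.2 hx hy hl hm hlm
    have hx : 0 ≤ x := hx
    have hy : 0 ≤ y := hy
    simp only [smul_eq_mul] at h1 ⊢
    rw [hgf _ (by positivity), hgf x hx, hgf y hy]
    have h2 : a = l * a + m * a := by rw [← add_mul, hlm, one_mul]
    nlinarith
  have hgint : ∫ y, g y ∂ρ' ≤ ∫ y, g y ∂ρ := by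
    have hgI : Integrable g ρ :=
      (hint.sub hI).congr (hρ.mono fun y hy => (hgf y hy).symm)
    rw [integral_eq_lintegral_of_nonneg_ae (hρ.mono hg0) hgm.aestronglyMeasurable,
      integral_eq_lintegral_of_nonneg_ae (hρ'.mono hg0) hgm.aestronglyMeasurable]
    refine ENNReal.toReal_mono ?_ (hconv g hgm hgc hg0)
    exact ((hasFiniteIntegral_iff_ofReal (hρ.mono hg0)).1 hgI.2).ne
  rw [integral_congr_ae (hρ.mono hgf), integral_congr_ae (hρ'.mono hgf), integral_sub hint hI,
    integral_sub hint' hI', hIeq] at hgint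
  linarith

section

variable {n : ℕ}

theorem Hmat_eq_opMat (W : Matrix (Fin n) (Fin n) ℝ) : Hmat W = opMat W := by
  ext β i j
  by_cases h : i = j
  · subst h
    simp [Hmat, opMat]
  · simp [Hmat, opMat, h]

theorem ofReal_nuDensity_zero (W : Matrix (Fin n) (Fin n) ℝ) (β : Fin n → ℝ) :
    ENNReal.ofReal (nuDensity W 0 β) =
      ENNReal.ofReal ((2 / Real.pi) ^ ((n : ℝ) / 2)) * dens (opMat W β) 0 := by
  rw [nuDensity, dens, Hmat_eq_opMat]
  split_ifs
  · rw [mul_assoc, ENNReal.ofReal_mul (by positivity)]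
  · simp

/-- The ratio `(∑ j, X j * G i j) / G i i` attached to a potential. -/
noncomputable def greenRatio (W : Matrix (Fin n) (Fin n) ℝ) (i : Fin n) (X β : Fin n → ℝ) : ℝ :=
  (∑ j, X j * (opMat W β)⁻¹ i j) / (opMat W β)⁻¹ i i

theorem measurable_greenRatio (W : Matrix (Fin n) (Fin n) ℝ) (i : Fin n) (X : Fin n → ℝ) :
    Measurable (greenRatio W i X) := by
  have h := measurable_ratio W (Pi.single i 1) X
  simp only [single_one_dotProduct, mulVec_single_one, col_apply] at h
  unfold greenRatio
  simpa only [mulVec, dotProduct, mul_comm] using h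

theorem lintegral_map_greenRatio {W : Matrix (Fin n) (Fin n) ℝ} (hWs : W.IsSymm) (i : Fin n)
    (X : Fin n → ℝ) {φ : ℝ → ℝ≥0∞} (hφ : Measurable φ) :
    ∫⁻ y, φ y ∂(nuMeasure W 0).map (greenRatio W i X) =
      ENNReal.ofReal ((2 / Real.pi) ^ ((n : ℝ) / 2)) * (rootMass * rootInt W i X φ) := by
  have hr := measurable_greenRatio W i X
  rw [lintegral_map hφ hr, nuMeasure]
  simp only [ofReal_nuDensity_zero]
  refine (lintegral_withDensity_eq_lintegral_mul _ ((measurable_dens W 0).const_mul _)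
    (hφ.comp hr)).trans ?_
  simp only [Pi.mul_apply, mul_assoc]
  rw [lintegral_const_mul' _ _ ENNReal.ofReal_ne_top]
  exact congrArg _ (lintegral_dens_ratio hWs i X hφ)

theorem ae_map_greenRatio_nonneg {W : Matrix (Fin n) (Fin n) ℝ} (hW : ∀ i j, 0 ≤ W i j)
    (i : Fin n) {X : Fin n → ℝ} (hX : ∀ j, 0 ≤ X j) :
    ∀ᵐ y ∂(nuMeasure W 0).map (greenRatio W i X), 0 ≤ y := by
  rw [ae_map_iff (measurable_greenRatio W i X).aemeasurable measurableSet_Ici, nuMeasure]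
  simp only [ofReal_nuDensity_zero]
  rw [ae_withDensity_iff ((measurable_dens W 0).const_mul _)]
  refine Filter.Eventually.of_forall fun β hβ => ?_
  by_cases hH : (opMat W β).PosDef
  · have hG := inv_opMat_apply_nonneg hW hH
    exact div_nonneg (Finset.sum_nonneg fun j _ => mul_nonneg (hX j) (hG i j)) (hG i i)
  · simp [dens_of_not_posDef hH] at hβ

theorem measurable_Hmat (W : Matrix (Fin n) (Fin n) ℝ) : Measurable (Hmat W) := by
  rw [Hmat_eq_opMat]
  exact measurable_pi_iff.2 fun i => measurable_pi_iff.2 fun j =>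
    ((continuous_opMat W).matrix_elem i j).measurable

theorem aestronglyMeasurable_map_greenRatio {W : Matrix (Fin n) (Fin n) ℝ}
    (hW : ∀ i j, 0 ≤ W i j) {i : Fin n} {X : Fin n → ℝ} (hX : ∀ j, 0 ≤ X j) {f : ℝ → ℝ}
    (hf : ConvexOn ℝ (Set.Ici 0) f) :
    AEStronglyMeasurable f ((nuMeasure W 0).map (greenRatio W i X)) :=
  (measurable_comp_max_zero hf).aestronglyMeasurable.congr
    ((ae_map_greenRatio_nonneg hW i hX).mono fun y hy => by simp only [max_eq_left hy])

theorem integral_nuTilde_eq {W : Matrix (Fin n) (Fin n) ℝ} (hW : ∀ i j, 0 ≤ W i j) {i : Fin n}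
    {X : Fin n → ℝ} (hX : ∀ j, 0 ≤ X j) {f : ℝ → ℝ} (hf : ConvexOn ℝ (Set.Ici 0) f)
    (hint : Integrable (fun H : Matrix (Fin n) (Fin n) ℝ =>
      f ((∑ j, X j * H⁻¹ i j) / H⁻¹ i i)) (nuTilde W 0)) :
    Integrable f ((nuMeasure W 0).map (greenRatio W i X)) ∧
      ∫ H, f ((∑ j, X j * H⁻¹ i j) / H⁻¹ i i) ∂(nuTilde W 0) =
        ∫ y, f y ∂(nuMeasure W 0).map (greenRatio W i X) := by
  have hf' := aestronglyMeasurable_map_greenRatio hW (i := i) hX hf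
  have hr := (measurable_greenRatio W i X).aemeasurable (μ := nuMeasure W 0)
  have hH := (measurable_Hmat W).aemeasurable (μ := nuMeasure W 0)
  have hm := hint.aestronglyMeasurable
  rw [nuTilde] at hint hm ⊢
  rw [integral_map hH hm, integral_map hr hf', integrable_map_measure hf' hr]
  rw [integrable_map_measure hm hH] at hint
  rw [Hmat_eq_opMat] at hint ⊢
  exact ⟨hint, rfl⟩

end

end VRJP

/-- monotonicity of convex expectations of the ratio
`(Σ_j X_j G(i,j)) / G(i,i)` under the measures ν̃_n^{W⁻,0} and ν̃_n^{W⁺,0}. -/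
theorem stmt0 {n : ℕ} (hn : 2 ≤ n)
    (Wm Wp : Matrix (Fin n) (Fin n) ℝ)
    (hWmSymm : Wm.IsSymm) (hWpSymm : Wp.IsSymm)
    (hWmDiag : ∀ i, Wm i i = 0) (hWpDiag : ∀ i, Wp i i = 0)
    (hWmNonneg : ∀ i j, i ≠ j → 0 ≤ Wm i j) (hWpNonneg : ∀ i j, i ≠ j → 0 ≤ Wp i j)
    (hle : ∀ i j, Wm i j ≤ Wp i j)
    (hconn : ∀ i j, HConnected Wm i j)
    (f : ℝ → ℝ) (hf : ConvexOn ℝ (Set.Ici 0) f)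
    (i : Fin n) (X : Fin n → ℝ) (hX : ∀ j, 0 ≤ X j)
    (hintm : Integrable (fun H : Matrix (Fin n) (Fin n) ℝ =>
      f ((∑ j, X j * H⁻¹ i j) / H⁻¹ i i)) (nuTilde Wm 0))
    (hintp : Integrable (fun H : Matrix (Fin n) (Fin n) ℝ =>
      f ((∑ j, X j * H⁻¹ i j) / H⁻¹ i i)) (nuTilde Wp 0)) :
    ∫ H, f ((∑ j, X j * H⁻¹ i j) / H⁻¹ i i) ∂(nuTilde Wm 0) ≥
      ∫ H, f ((∑ j, X j * H⁻¹ i j) / H⁻¹ i i) ∂(nuTilde Wp 0) := by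
  have hWm : ∀ i j, 0 ≤ Wm i j := fun i j => by
    by_cases h : i = j
    · rw [h, hWmDiag]
    · exact hWmNonneg i j h
  have hWp : ∀ i j, 0 ≤ Wp i j := fun i j => (hWm i j).trans (hle i j)
  have hconnp : ∀ j, Relation.ReflTransGen (fun a b => Wp a b ≠ 0) j i := fun j =>
    Relation.ReflTransGen.mono (fun a b h => (((hWm a b).lt_of_ne' h).trans_le (hle a b)).ne')
      j i (hconn j i)
  obtain ⟨hm, hm'⟩ := VRJP.integral_nuTilde_eq hWm hX hf hintm
  obtain ⟨hp, hp'⟩ := VRJP.integral_nuTilde_eq hWp hX hf hintp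
  rw [ge_iff_le, hm', hp']
  refine VRJP.integral_convexOn_le hf (VRJP.ae_map_greenRatio_nonneg hWm i hX)
    (VRJP.ae_map_greenRatio_nonneg hWp i hX) hm hp (fun z hz => ?_) (fun z hz => ?_)
    fun g hg hgc hg0 => ?_
  · have hφ : Measurable fun y : ℝ => ENNReal.ofReal (z + y) := by fun_prop
    rw [VRJP.lintegral_map_greenRatio hWpSymm i X hφ, VRJP.lintegral_map_greenRatio hWmSymm i X hφ,
      VRJP.rootInt_affine hWpSymm hWp hconnp hX hz,
      VRJP.rootInt_affine hWmSymm hWm (fun j => hconn j i) hX hz]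
  · have hφ : Measurable fun y : ℝ => ENNReal.ofReal (z + y) := by fun_prop
    rw [VRJP.lintegral_map_greenRatio hWmSymm i X hφ,
      VRJP.rootInt_affine hWmSymm hWm (fun j => hconn j i) hX hz]
    exact ENNReal.mul_ne_top ENNReal.ofReal_ne_top (ENNReal.mul_ne_top VRJP.rootMass_ne_top
      (ENNReal.mul_ne_top (ENNReal.pow_ne_top (ENNReal.mul_ne_top (by simp) VRJP.gaussMass_ne_top))
        ENNReal.ofReal_ne_top))
  · rw [VRJP.lintegral_map_greenRatio hWpSymm i X hg.ennreal_ofReal,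
      VRJP.lintegral_map_greenRatio hWmSymm i X hg.ennreal_ofReal]
    gcongr
    exact VRJP.rootInt_anti hWmSymm hWpSymm (fun j => by rw [hWmDiag, hWpDiag]) hWm hle
      (fun j => hconn j i) hX hg hgc hg0
end

section
/- Fix w ≥ 0 and λ ∈ [0,1], with λ ∉ {0,1} if w = 0, and let W := [[0,w],[w,0]]. Let (β₁,β₂) be distributed according to ν_2^{W,0} and define γ := (4β₁β₂ − w²)/(2wλ(1−λ) + 2β₂λ² + 2β₁(1−λ)²). Then the law of γ is the Gamma distribution with shape 1/2 and rate 1/2; that is, the pushforward of ν_2^{W,0} under (β₁,β₂) ↦ γ is the measure on (0,∞) with density c ↦ (1/√(2π)) · c^{-1/2} · e^{-c/2}. -/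
open scoped Classical

open MeasureTheory Matrix

/-- `exp (-(s - p)² / (2 s)) / √s`, an unnormalised reciprocal inverse Gaussian density. -/
noncomputable def rigKernel (p s : ℝ) : ℝ :=
  Real.exp (-((s - p) ^ 2 / (2 * s))) / Real.sqrt s

lemma rigKernel_nonneg (p s : ℝ) : 0 ≤ rigKernel p s := by
  unfold rigKernel; positivity

@[fun_prop]
lemma Measurable.rigKernel {α : Type*} [MeasurableSpace α] {f g : α → ℝ}
    (hf : Measurable f) (hg : Measurable g) : Measurable fun x => rigKernel (f x) (g x) := by
  unfold _root_.rigKernel; fun_prop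

lemma lintegral_gaussian_half :
    ∫⁻ t : ℝ, ENNReal.ofReal (Real.exp (-(t ^ 2 / 2))) =
      ENNReal.ofReal (Real.sqrt (2 * Real.pi)) := by
  have h (t : ℝ) : Real.exp (-(t ^ 2 / 2)) = Real.exp (-(1 / 2) * t ^ 2) := by
    congr 1; ring
  simp_rw [h]
  rw [← ofReal_integral_eq_lintegral_ofReal (integrable_exp_neg_mul_sq (by norm_num))
    (ae_of_all _ fun t => (Real.exp_pos _).le), integral_gaussian]
  congr 2; ring

lemma lintegral_rigKernel_inversion {p : ℝ} (hp : 0 < p) :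
    ∫⁻ s in Set.Ioi (0 : ℝ), ENNReal.ofReal (p / s * rigKernel p s) =
      ∫⁻ s in Set.Ioi (0 : ℝ), ENNReal.ofReal (rigKernel p s) := by
  have himg : (fun s : ℝ => p ^ 2 / s) '' Set.Ioi 0 = Set.Ioi 0 := by
    ext t
    simp only [Set.mem_image, Set.mem_Ioi]
    constructor
    · rintro ⟨s, hs, rfl⟩; positivity
    · intro ht; exact ⟨p ^ 2 / t, by positivity, by field_simp⟩
  have hderiv : ∀ s ∈ Set.Ioi (0 : ℝ),
      HasDerivWithinAt (fun s : ℝ => p ^ 2 / s) (-(p ^ 2 / s ^ 2)) (Set.Ioi 0) s := by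
    intro s hs
    have h := ((hasDerivAt_inv (ne_of_gt (Set.mem_Ioi.1 hs))).const_mul (p ^ 2)).hasDerivWithinAt
      (s := Set.Ioi 0)
    simpa [div_eq_mul_inv] using h
  have hinj : Set.InjOn (fun s : ℝ => p ^ 2 / s) (Set.Ioi 0) := by
    intro a ha b hb hab
    have ha' : 0 < a := ha
    have hb' : 0 < b := hb
    simp only at hab
    field_simp at hab
    exact hab.symm
  have h := lintegral_image_eq_lintegral_abs_deriv_mul measurableSet_Ioi hderiv hinj
    (fun s => ENNReal.ofReal (rigKernel p s))
  rw [himg] at h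
  rw [h]
  refine setLIntegral_congr_fun measurableSet_Ioi fun s hs => ?_
  have hs : 0 < s := hs
  have hsq : 0 < Real.sqrt s := Real.sqrt_pos.2 hs
  rw [← ENNReal.ofReal_mul (abs_nonneg _), abs_neg, abs_of_pos (by positivity)]
  congr 1
  unfold rigKernel
  rw [Real.sqrt_div (sq_nonneg p), Real.sqrt_sq hp.le]
  have he : (p ^ 2 / s - p) ^ 2 / (2 * (p ^ 2 / s)) = (s - p) ^ 2 / (2 * s) := by
    field_simp; ring
  rw [he]
  field_simp
  rw [Real.sq_sqrt hs.le]

lemma lintegral_one_add_mul_rigKernel {p : ℝ} (hp : 0 < p) :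
    ∫⁻ s in Set.Ioi (0 : ℝ), ENNReal.ofReal ((1 + p / s) * rigKernel p s) =
      2 * ENNReal.ofReal (Real.sqrt (2 * Real.pi)) := by
  set f : ℝ → ℝ := fun s => Real.sqrt s - p / Real.sqrt s with hf
  have hderiv : ∀ s ∈ Set.Ioi (0 : ℝ),
      HasDerivWithinAt f ((1 + p / s) / (2 * Real.sqrt s)) (Set.Ioi 0) s := by
    intro s hs
    have hs : 0 < s := hs
    have hsq : 0 < Real.sqrt s := Real.sqrt_pos.2 hs
    have h1 := Real.hasDerivAt_sqrt hs.ne'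
    have h2 := h1.sub ((h1.inv hsq.ne').const_mul p)
    have h3 := h2.hasDerivWithinAt (s := Set.Ioi 0)
    refine (h3.congr_deriv ?_).congr (fun x _ => ?_) ?_
    · rw [Real.sq_sqrt hs.le]; field_simp; ring
    · simp [hf, div_eq_mul_inv]
    · simp [hf, div_eq_mul_inv]
  have hmono : StrictMonoOn f (Set.Ioi 0) := by
    intro a ha b hb hab
    have ha' : 0 < Real.sqrt a := Real.sqrt_pos.2 ha
    have h := Real.sqrt_lt_sqrt (le_of_lt ha) hab
    have h' := div_lt_div_of_pos_left hp ha' h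
    simp only [hf]; linarith
  have himg : f '' Set.Ioi 0 = Set.univ := by
    refine Set.eq_univ_of_forall fun t => ?_
    have hd : |t| < Real.sqrt (t ^ 2 + 4 * p) := by
      rw [← Real.sqrt_sq_eq_abs]; exact Real.sqrt_lt_sqrt (sq_nonneg _) (by linarith)
    have hr : 0 < (t + Real.sqrt (t ^ 2 + 4 * p)) / 2 := by
      have := neg_abs_le t; linarith
    have hsq := Real.sq_sqrt (show 0 ≤ t ^ 2 + 4 * p by positivity)
    set d := Real.sqrt (t ^ 2 + 4 * p)
    refine ⟨((t + d) / 2) ^ 2, Set.mem_Ioi.2 (by positivity), ?_⟩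
    simp only [hf]
    rw [Real.sqrt_sq hr.le]
    have : t + d ≠ 0 := by linarith
    field_simp
    nlinarith
  have h := lintegral_image_eq_lintegral_abs_deriv_mul measurableSet_Ioi hderiv hmono.injOn
    (fun t => 2 * ENNReal.ofReal (Real.exp (-(t ^ 2 / 2))))
  rw [himg, setLIntegral_univ, lintegral_const_mul _ (by fun_prop), lintegral_gaussian_half] at h
  rw [h]
  refine setLIntegral_congr_fun measurableSet_Ioi fun s hs => ?_
  have hs : 0 < s := hs
  have hsq : 0 < Real.sqrt s := Real.sqrt_pos.2 hs
  rw [abs_of_pos (by positivity), ← ENNReal.ofReal_ofNat, ← ENNReal.ofReal_mul (by norm_num),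
    ← ENNReal.ofReal_mul (by positivity)]
  congr 1
  unfold rigKernel
  have he : f s ^ 2 / 2 = (s - p) ^ 2 / (2 * s) := by
    simp only [hf]
    have h2 : Real.sqrt s - p / Real.sqrt s = (s - p) / Real.sqrt s := by
      field_simp; rw [Real.sq_sqrt hs.le]
    rw [h2, div_pow, Real.sq_sqrt hs.le]; field_simp
  rw [he]
  field_simp

lemma lintegral_rigKernel {p : ℝ} (hp : 0 < p) :
    ∫⁻ s in Set.Ioi (0 : ℝ), ENNReal.ofReal (rigKernel p s) =
      ENNReal.ofReal (Real.sqrt (2 * Real.pi)) := by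
  have h := lintegral_one_add_mul_rigKernel hp
  have h2 : ∫⁻ s in Set.Ioi (0 : ℝ), ENNReal.ofReal ((1 + p / s) * rigKernel p s) =
      (∫⁻ s in Set.Ioi (0 : ℝ), ENNReal.ofReal (rigKernel p s)) +
      ∫⁻ s in Set.Ioi (0 : ℝ), ENNReal.ofReal (p / s * rigKernel p s) := by
    rw [← lintegral_add_left (by fun_prop)]
    refine setLIntegral_congr_fun measurableSet_Ioi fun s hs => ?_
    have hs : 0 < s := hs
    have := rigKernel_nonneg p s
    rw [← ENNReal.ofReal_add this (by positivity)]
    congr 1; ring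
  rw [h2, lintegral_rigKernel_inversion hp, ← two_mul] at h
  exact (ENNReal.mul_right_inj (by norm_num) (by norm_num)).1 h

lemma lintegral_convex_mul_rigKernel {p l m : ℝ} (hp : 0 < p) (hl : 0 ≤ l) (hm : 0 ≤ m)
    (hlm : l + m = 1) :
    ∫⁻ s in Set.Ioi (0 : ℝ), ENNReal.ofReal ((m + l * (p / s)) * rigKernel p s) =
      ENNReal.ofReal (Real.sqrt (2 * Real.pi)) := by
  have h : ∫⁻ s in Set.Ioi (0 : ℝ), ENNReal.ofReal ((m + l * (p / s)) * rigKernel p s) =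
      ENNReal.ofReal m * (∫⁻ s in Set.Ioi (0 : ℝ), ENNReal.ofReal (rigKernel p s)) +
      ENNReal.ofReal l * ∫⁻ s in Set.Ioi (0 : ℝ), ENNReal.ofReal (p / s * rigKernel p s) := by
    rw [← lintegral_const_mul _ (by fun_prop), ← lintegral_const_mul _ (by fun_prop),
      ← lintegral_add_left (by fun_prop)]
    refine setLIntegral_congr_fun measurableSet_Ioi fun s hs => ?_
    have hs : 0 < s := hs
    have := rigKernel_nonneg p s
    rw [← ENNReal.ofReal_mul hm, ← ENNReal.ofReal_mul hl,
      ← ENNReal.ofReal_add (by positivity) (by positivity)]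
    congr 1; ring
  rw [h, lintegral_rigKernel_inversion hp, lintegral_rigKernel hp, ← add_mul,
    ← ENNReal.ofReal_add hm hl, add_comm m l, hlm, ENNReal.ofReal_one, one_mul]

lemma posDef_Hmat_two_iff (w : ℝ) (β : Fin 2 → ℝ) :
    (Hmat !![0, w; w, 0] β).PosDef ↔ 0 < β 0 ∧ w ^ 2 < 4 * β 0 * β 1 := by
  constructor
  · intro h
    have h0 := h.diag_pos (i := 0)
    have hd := h.det_pos
    simp [Hmat, det_fin_two] at h0 hd
    exact ⟨h0, by nlinarith⟩
  · rintro ⟨h0, hd⟩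
    refine PosDef.of_dotProduct_mulVec_pos ?_ fun {v} hv => ?_
    · ext i j
      fin_cases i <;> fin_cases j <;> simp [Hmat]
    · have hq : star v ⬝ᵥ (Hmat !![0, w; w, 0] β *ᵥ v) =
          ((2 * β 0 * v 0 - w * v 1) ^ 2 + (4 * β 0 * β 1 - w ^ 2) * v 1 ^ 2) / (2 * β 0) := by
        simp [Hmat, dotProduct, mulVec, Fin.sum_univ_two]
        field_simp
        ring
      rw [hq]
      refine div_pos ?_ (by linarith)
      by_cases h1 : v 1 = 0
      · have h2 : v 0 ≠ 0 := by
          intro h2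
          apply hv
          ext i
          fin_cases i <;> simp [h1, h2]
        rw [h1]
        have : 0 < (2 * β 0 * v 0) ^ 2 := by positivity
        nlinarith
      · have : 0 < (4 * β 0 * β 1 - w ^ 2) * v 1 ^ 2 :=
          mul_pos (by linarith) (by positivity)
        positivity

/-- The density of `ν_2^{W,0}` for `W = [[0,w],[w,0]]`, in explicit form. -/
noncomputable def nuDensityTwo (w x y : ℝ) : ℝ :=
  if 0 < x ∧ w ^ 2 < 4 * x * y then
    2 / Real.pi * Real.exp (-(x + y - w)) * (Real.sqrt (4 * x * y - w ^ 2))⁻¹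
  else 0

lemma nuDensity_two (w : ℝ) (β : Fin 2 → ℝ) :
    nuDensity !![0, w; w, 0] 0 β = nuDensityTwo w (β 0) (β 1) := by
  have hdet : (Hmat !![0, w; w, 0] β).det = 4 * β 0 * β 1 - w ^ 2 := by
    simp [Hmat, det_fin_two]; ring
  simp only [nuDensity, nuDensityTwo, posDef_Hmat_two_iff, hdet]
  refine if_congr Iff.rfl ?_ rfl
  congr 2
  · norm_num
  · congr 1
    simp [Hmat, Fin.sum_univ_two]
    ring

lemma measurable_nuDensityTwo (w : ℝ) :
    Measurable fun z : ℝ × ℝ => nuDensityTwo w z.1 z.2 := by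
  unfold nuDensityTwo
  refine Measurable.ite ?_ (by fun_prop) measurable_const
  exact (measurableSet_lt measurable_const measurable_fst).inter
    (measurableSet_lt (g := fun z : ℝ × ℝ => 4 * z.1 * z.2) measurable_const (by fun_prop))

/-- The map `γ = 1 / ⟨u, H_β⁻¹ u⟩` for `u = (l, m)` and `β = (x, y)`. -/
noncomputable def gammaMap (w l m x y : ℝ) : ℝ :=
  (4 * x * y - w ^ 2) / (2 * w * l * m + 2 * y * l ^ 2 + 2 * x * m ^ 2)

/-- The inverse of `y ↦ gammaMap w l m x y`. -/
noncomputable def gammaInv (w l m x c : ℝ) : ℝ :=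
  (c * m ^ 2 + (w + c * l * m) ^ 2 / (2 * x - c * l ^ 2)) / 2

/-- The joint density of `γ` and `s = 2 β₁ - γ l²`, up to the factor `2`. -/
noncomputable def gammaJoint (w l m c s : ℝ) : ℝ :=
  Real.exp (-(c / 2)) / (Real.pi * Real.sqrt c) *
    ((m + l * ((w + c * l * m) / s)) * rigKernel (w + c * l * m) s)

section

variable {w l m : ℝ}

lemma four_mul_gammaInv_sub {x c : ℝ} (hs : 0 < 2 * x - c * l ^ 2) :
    4 * x * gammaInv w l m x c - w ^ 2 =
      c * (l * (w + c * l * m) + m * (2 * x - c * l ^ 2)) ^ 2 / (2 * x - c * l ^ 2) := by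
  unfold gammaInv
  generalize hS : 2 * x - c * l ^ 2 = s at *
  obtain rfl : x = (s + c * l ^ 2) / 2 := by linarith
  field_simp
  ring

lemma add_gammaInv_sub (hlm : l + m = 1) {x c : ℝ} (hs : 0 < 2 * x - c * l ^ 2) :
    x + gammaInv w l m x c - w = c / 2 +
      (2 * x - c * l ^ 2 - (w + c * l * m)) ^ 2 / (2 * (2 * x - c * l ^ 2)) := by
  unfold gammaInv
  generalize hS : 2 * x - c * l ^ 2 = s at *
  obtain rfl : x = (s + c * l ^ 2) / 2 := by linarith
  obtain rfl : m = 1 - l := by linarith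
  field_simp
  ring

lemma gammaMap_gammaInv {x c : ℝ} (hs : 0 < 2 * x - c * l ^ 2)
    (hd : 0 < l * (w + c * l * m) + m * (2 * x - c * l ^ 2)) :
    gammaMap w l m x (gammaInv w l m x c) = c := by
  have hden : 2 * w * l * m + 2 * gammaInv w l m x c * l ^ 2 + 2 * x * m ^ 2 =
      (l * (w + c * l * m) + m * (2 * x - c * l ^ 2)) ^ 2 / (2 * x - c * l ^ 2) := by
    unfold gammaInv
    generalize hS : 2 * x - c * l ^ 2 = s at *
    obtain rfl : x = (s + c * l ^ 2) / 2 := by linarith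
    field_simp
    ring
  rw [gammaMap, four_mul_gammaInv_sub hs, hden]
  field_simp

lemma hasDerivAt_gammaInv {x c : ℝ} (hs : 0 < 2 * x - c * l ^ 2) :
    HasDerivAt (gammaInv w l m x)
      ((m + l * ((w + c * l * m) / (2 * x - c * l ^ 2))) ^ 2 / 2) c := by
  have h1 : HasDerivAt (fun c => 2 * x - c * l ^ 2) (-(l ^ 2)) c := by
    simpa using ((hasDerivAt_id c).mul_const (l ^ 2)).const_sub (2 * x)
  have h2 : HasDerivAt (fun c => w + c * l * m) (l * m) c := by
    simpa [mul_assoc] using ((hasDerivAt_id c).mul_const (l * m)).const_add w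
  have h3 := ((((hasDerivAt_id c).mul_const (m ^ 2)).add ((h2.pow 2).div h1 hs.ne')).div_const 2)
  refine (h3.congr_deriv ?_).congr_of_eventuallyEq ?_
  · simp only [Pi.pow_apply]
    field_simp
    ring
  · exact Filter.Eventually.of_forall fun c => by simp [gammaInv]

lemma gammaInv_gammaMap {x y : ℝ}
    (hD : 0 < 2 * w * l * m + 2 * y * l ^ 2 + 2 * x * m ^ 2) (hn : 0 < w * l + 2 * x * m) :
    0 < 2 * x - gammaMap w l m x y * l ^ 2 ∧ gammaInv w l m x (gammaMap w l m x y) = y := by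
  have hs : 2 * x - gammaMap w l m x y * l ^ 2 =
      (w * l + 2 * x * m) ^ 2 / (2 * w * l * m + 2 * y * l ^ 2 + 2 * x * m ^ 2) := by
    unfold gammaMap
    generalize hE : 2 * w * l * m + 2 * y * l ^ 2 + 2 * x * m ^ 2 = D at *
    field_simp
    rw [← hE]
    ring
  have hp : w + gammaMap w l m x y * l * m =
      (w * l + 2 * x * m) * (2 * y * l + w * m) /
        (2 * w * l * m + 2 * y * l ^ 2 + 2 * x * m ^ 2) := by
    unfold gammaMap
    generalize hE : 2 * w * l * m + 2 * y * l ^ 2 + 2 * x * m ^ 2 = D at *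
    field_simp
    rw [← hE]
    ring
  refine ⟨by rw [hs]; positivity, ?_⟩
  rw [gammaInv, hs, hp, gammaMap]
  generalize hE : 2 * w * l * m + 2 * y * l ^ 2 + 2 * x * m ^ 2 = D at *
  generalize w * l + 2 * x * m = N at *
  field_simp
  rw [← hE]
  ring

lemma lintegral_nuDensityTwo_section (hw : 0 ≤ w) (hl : 0 ≤ l) (hm : 0 ≤ m) (hlm : l + m = 1)
    (hnd : 0 < w ∨ 0 < l ∧ 0 < m) (F : ℝ → ENNReal) (x : ℝ) :
    ∫⁻ y, ENNReal.ofReal (nuDensityTwo w x y) * F (gammaMap w l m x y) =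
      ∫⁻ c, if 0 < c ∧ c * l ^ 2 < 2 * x then
        ENNReal.ofReal (gammaJoint w l m c (2 * x - c * l ^ 2)) * F c else 0 := by
  rcases le_or_gt x 0 with hx | hx
  · have h1 (y : ℝ) : nuDensityTwo w x y = 0 := if_neg fun h => absurd h.1 (not_lt.2 hx)
    have h2 (c : ℝ) : ¬ (0 < c ∧ c * l ^ 2 < 2 * x) := by
      rintro ⟨hc, h⟩
      have : 0 ≤ c * l ^ 2 := by positivity
      linarith
    simp [h1, h2]
  set S : Set ℝ := {c | 0 < c ∧ c * l ^ 2 < 2 * x}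
  have hSm : MeasurableSet S :=
    (measurableSet_lt measurable_const measurable_id).inter
      (measurableSet_lt (measurable_id.mul_const _) measurable_const)
  have hTm : MeasurableSet {y : ℝ | w ^ 2 < 4 * x * y} :=
    measurableSet_lt measurable_const (by fun_prop)
  have hpos : ∀ c ∈ S, 0 < 2 * x - c * l ^ 2 ∧ 0 < w + c * l * m ∧
      0 < l * (w + c * l * m) + m * (2 * x - c * l ^ 2) := by
    rintro c ⟨hc, h⟩
    have hs : 0 < 2 * x - c * l ^ 2 := by linarith
    have hp : 0 < w + c * l * m := by
      rcases hnd with h | ⟨h1, h2⟩ <;> positivity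
    refine ⟨hs, hp, ?_⟩
    rcases hl.lt_or_eq with h | h
    · positivity
    · have : 0 < m := by linarith
      positivity
  have hinv : Set.LeftInvOn (gammaMap w l m x) (gammaInv w l m x) S := fun c hc =>
    gammaMap_gammaInv (hpos c hc).1 (hpos c hc).2.2
  have himg : gammaInv w l m x '' S = {y | w ^ 2 < 4 * x * y} := by
    ext y
    constructor
    · rintro ⟨c, hc, rfl⟩
      obtain ⟨hs, hp, hd⟩ := hpos c hc
      have hc0 : 0 < c := hc.1
      have h := four_mul_gammaInv_sub (w := w) (m := m) hs
      have h2 : 0 < c * (l * (w + c * l * m) + m * (2 * x - c * l ^ 2)) ^ 2 /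
          (2 * x - c * l ^ 2) := by positivity
      exact sub_pos.1 (h ▸ h2)
    · intro hy
      have hy : w ^ 2 < 4 * x * y := hy
      have hy0 : 0 < y := by
        have : 0 < 4 * x * y := (sq_nonneg w).trans_lt hy
        exact pos_of_mul_pos_right this (by positivity)
      have hD : 0 < 2 * w * l * m + 2 * y * l ^ 2 + 2 * x * m ^ 2 := by
        rcases hl.lt_or_eq with h | h
        · positivity
        · have : 0 < m := by linarith
          positivity
      have hn : 0 < w * l + 2 * x * m := by
        rcases hm.lt_or_eq with h | h
        · positivity
        · have : 0 < l := by linarith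
          have : 0 < w := hnd.resolve_right fun h' => h'.2.ne h
          positivity
      obtain ⟨h1, h2⟩ := gammaInv_gammaMap hD hn
      exact ⟨gammaMap w l m x y, ⟨div_pos (by linarith) hD, by linarith⟩, h2⟩
  calc ∫⁻ y, ENNReal.ofReal (nuDensityTwo w x y) * F (gammaMap w l m x y)
      = ∫⁻ y in gammaInv w l m x '' S,
          ENNReal.ofReal (nuDensityTwo w x y) * F (gammaMap w l m x y) := by
        rw [himg, ← lintegral_indicator hTm]
        refine lintegral_congr fun y => ?_
        by_cases hy : w ^ 2 < 4 * x * y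
        · rw [Set.indicator_of_mem (show y ∈ {y : ℝ | w ^ 2 < 4 * x * y} from hy)]
        · rw [Set.indicator_of_notMem (show y ∉ {y : ℝ | w ^ 2 < 4 * x * y} from hy),
            nuDensityTwo, if_neg fun h => hy h.2, ENNReal.ofReal_zero, zero_mul]
    _ = ∫⁻ c in S, ENNReal.ofReal (gammaJoint w l m c (2 * x - c * l ^ 2)) * F c := by
        rw [lintegral_image_eq_lintegral_abs_deriv_mul hSm
          (fun c hc => (hasDerivAt_gammaInv (hpos c hc).1).hasDerivWithinAt) hinv.injOn]
        refine setLIntegral_congr_fun hSm fun c hc => ?_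
        obtain ⟨hs, hp, hd⟩ := hpos c hc
        have hc0 : 0 < c := hc.1
        have hlt : w ^ 2 < 4 * x * gammaInv w l m x c := by
          have : gammaInv w l m x c ∈ {y | w ^ 2 < 4 * x * y} := himg ▸ Set.mem_image_of_mem _ hc
          exact this
        rw [hinv hc, ← mul_assoc, ← ENNReal.ofReal_mul (abs_nonneg _), abs_of_nonneg (by positivity)]
        congr 2
        rw [nuDensityTwo, if_pos ⟨hx, hlt⟩, add_gammaInv_sub hlm hs, four_mul_gammaInv_sub hs,
          gammaJoint, rigKernel, neg_add, Real.exp_add, Real.sqrt_div (by positivity),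
          Real.sqrt_mul hc0.le, Real.sqrt_sq hd.le]
        generalize 2 * x - c * l ^ 2 = s at *
        generalize w + c * l * m = p at *
        have hsq : 0 < Real.sqrt s := Real.sqrt_pos.2 hs
        have hcq : 0 < Real.sqrt c := Real.sqrt_pos.2 hc0
        have hmp : m + l * (p / s) = (l * p + m * s) / s := by field_simp; ring
        rw [hmp]
        generalize l * p + m * s = d at *
        field_simp
        rw [show Real.sqrt s ^ 2 = s from Real.sq_sqrt hs.le]
    _ = _ := by
        rw [← lintegral_indicator hSm]
        refine lintegral_congr fun c => ?_
        rw [Set.indicator_apply]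
        exact if_congr Iff.rfl rfl rfl

lemma lintegral_gammaJoint (hw : 0 ≤ w) (hl : 0 ≤ l) (hm : 0 ≤ m) (hlm : l + m = 1)
    (hnd : 0 < w ∨ 0 < l ∧ 0 < m) (a : ENNReal) {c : ℝ} (hc : 0 < c) :
    ∫⁻ x, (if 0 < c ∧ c * l ^ 2 < 2 * x then
        ENNReal.ofReal (gammaJoint w l m c (2 * x - c * l ^ 2)) * a else 0) =
      ENNReal.ofReal ((Real.sqrt (2 * Real.pi))⁻¹ * (Real.sqrt c)⁻¹ * Real.exp (-(c / 2))) * a := by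
  have hp : 0 < w + c * l * m := by
    rcases hnd with h | ⟨h1, h2⟩ <;> positivity
  set S : Set ℝ := Set.Ioi (c * l ^ 2 / 2)
  have himg : (fun x : ℝ => 2 * x - c * l ^ 2) '' S = Set.Ioi 0 := by
    ext s
    constructor
    · rintro ⟨x, hx, rfl⟩
      have hx : c * l ^ 2 / 2 < x := hx
      simp only [Set.mem_Ioi]
      linarith
    · intro hs
      have hs : 0 < s := hs
      exact ⟨(s + c * l ^ 2) / 2, Set.mem_Ioi.2 (by linarith), by simp only; ring⟩
  have hderiv : ∀ x ∈ S, HasDerivWithinAt (fun x : ℝ => 2 * x - c * l ^ 2) 2 S x := fun x _ => by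
    simpa using (((hasDerivAt_id x).const_mul 2).sub_const (c * l ^ 2)).hasDerivWithinAt (s := S)
  have hinj : Set.InjOn (fun x : ℝ => 2 * x - c * l ^ 2) S := fun x _ y _ h => by
    simp only at h; linarith
  have hker := lintegral_convex_mul_rigKernel hp hl hm hlm
  have hcov := lintegral_image_eq_lintegral_abs_deriv_mul measurableSet_Ioi hderiv hinj
    (fun s => ENNReal.ofReal ((m + l * ((w + c * l * m) / s)) * rigKernel (w + c * l * m) s))
  rw [himg, hker] at hcov
  set b : ℝ := Real.exp (-(c / 2)) / (Real.pi * Real.sqrt c) / 2 with hb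
  have hb0 : 0 ≤ b := by positivity
  calc _ = ∫⁻ x in S, ENNReal.ofReal b * (ENNReal.ofReal |2| *
        ENNReal.ofReal ((m + l * ((w + c * l * m) / (2 * x - c * l ^ 2))) *
          rigKernel (w + c * l * m) (2 * x - c * l ^ 2))) * a := by
        rw [← lintegral_indicator measurableSet_Ioi]
        refine lintegral_congr fun x => ?_
        by_cases hx : c * l ^ 2 / 2 < x
        · rw [Set.indicator_of_mem (show x ∈ S from hx), if_pos ⟨hc, by linarith⟩, ← mul_assoc,
            ← ENNReal.ofReal_mul hb0, ← ENNReal.ofReal_mul (by positivity)]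
          congr 2
          rw [gammaJoint, hb, abs_of_pos (by norm_num)]
          ring
        · rw [Set.indicator_of_notMem (show x ∉ S from hx), if_neg fun h => hx (by linarith [h.2])]
    _ = ENNReal.ofReal b * ENNReal.ofReal (Real.sqrt (2 * Real.pi)) * a := by
        rw [lintegral_mul_const _ (by fun_prop), lintegral_const_mul _ (by fun_prop), ← hcov]
    _ = _ := by
        rw [← ENNReal.ofReal_mul hb0]
        congr 2
        have h2 : 0 < Real.sqrt (2 * Real.pi) := Real.sqrt_pos.2 (by positivity)
        have hcq : 0 < Real.sqrt c := Real.sqrt_pos.2 hc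
        rw [hb]
        field_simp
        rw [Real.sq_sqrt (by positivity)]

lemma measurable_gammaJoint :
    Measurable fun z : ℝ × ℝ => gammaJoint w l m z.2 (2 * z.1 - z.2 * l ^ 2) := by
  unfold gammaJoint
  fun_prop

lemma measurable_gammaMap : Measurable fun z : ℝ × ℝ => gammaMap w l m z.1 z.2 := by
  unfold gammaMap
  fun_prop

lemma lintegral_nuMeasure_gammaMap (hw : 0 ≤ w) (hl : 0 ≤ l) (hm : 0 ≤ m) (hlm : l + m = 1)
    (hnd : 0 < w ∨ 0 < l ∧ 0 < m) {F : ℝ → ENNReal} (hF : Measurable F) :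
    ∫⁻ β, F (gammaMap w l m (β 0) (β 1)) ∂(nuMeasure !![0, w; w, 0] 0) =
      ∫⁻ c, ENNReal.ofReal (if 0 < c then
          (Real.sqrt (2 * Real.pi))⁻¹ * (Real.sqrt c)⁻¹ * Real.exp (-(c / 2)) else 0) * F c := by
  have hQ := measurable_nuDensityTwo w
  have hG := measurable_gammaMap (w := w) (l := l) (m := m)
  have hJ := measurable_gammaJoint (w := w) (l := l) (m := m)
  have hcoord : Measurable fun β : Fin 2 → ℝ => (β 0, β 1) := by fun_prop
  simp_rw [nuMeasure, nuDensity_two]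
  calc _ = ∫⁻ β : Fin 2 → ℝ,
          ENNReal.ofReal (nuDensityTwo w (β 0) (β 1)) * F (gammaMap w l m (β 0) (β 1)) :=
        lintegral_withDensity_eq_lintegral_mul _ (hQ.comp hcoord).ennreal_ofReal
          (hF.comp (hG.comp hcoord))
    _ = ∫⁻ z : ℝ × ℝ, ENNReal.ofReal (nuDensityTwo w z.1 z.2) * F (gammaMap w l m z.1 z.2) :=
        (volume_preserving_finTwoArrow ℝ).lintegral_comp
          (f := fun z : ℝ × ℝ => ENNReal.ofReal (nuDensityTwo w z.1 z.2) *
            F (gammaMap w l m z.1 z.2)) (hQ.ennreal_ofReal.mul (hF.comp hG))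
    _ = ∫⁻ x, ∫⁻ y, ENNReal.ofReal (nuDensityTwo w x y) * F (gammaMap w l m x y) :=
        lintegral_prod _ (hQ.ennreal_ofReal.mul (hF.comp hG)).aemeasurable
    _ = ∫⁻ x, ∫⁻ c, if 0 < c ∧ c * l ^ 2 < 2 * x then
          ENNReal.ofReal (gammaJoint w l m c (2 * x - c * l ^ 2)) * F c else 0 :=
        lintegral_congr fun x => lintegral_nuDensityTwo_section hw hl hm hlm hnd F x
    _ = ∫⁻ c, ∫⁻ x, if 0 < c ∧ c * l ^ 2 < 2 * x then
          ENNReal.ofReal (gammaJoint w l m c (2 * x - c * l ^ 2)) * F c else 0 := by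
        refine lintegral_lintegral_swap (Measurable.aemeasurable ?_)
        refine Measurable.ite ?_ (hJ.ennreal_ofReal.mul (hF.comp measurable_snd)) measurable_const
        exact (measurableSet_lt measurable_const measurable_snd).inter
          (measurableSet_lt (f := fun z : ℝ × ℝ => z.2 * l ^ 2) (g := fun z => 2 * z.1)
            (by fun_prop) (by fun_prop))
    _ = _ := by
        refine lintegral_congr fun c => ?_
        by_cases hc : 0 < c
        · rw [if_pos hc, lintegral_gammaJoint hw hl hm hlm hnd (F c) hc]
        · simp [hc]

end

/-- under ν_2^{W,0} with W = [[0,w],[w,0]], the variable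
γ = (4β₁β₂ − w²)/(2wλ(1−λ) + 2β₂λ² + 2β₁(1−λ)²) has the Gamma(1/2,1/2)
distribution, i.e. density c ↦ (1/√(2π))·c^{-1/2}·e^{-c/2} on (0,∞). -/
theorem stmt7 (w lam : ℝ) (hw : 0 ≤ w) (hlam : lam ∈ Set.Icc (0 : ℝ) 1)
    (hw0 : w = 0 → lam ≠ 0 ∧ lam ≠ 1) :
    (nuMeasure !![0, w; w, 0] 0).map
        (fun β : Fin 2 → ℝ =>
          (4 * β 0 * β 1 - w ^ 2) /
            (2 * w * lam * (1 - lam) + 2 * β 1 * lam ^ 2 + 2 * β 0 * (1 - lam) ^ 2)) =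
      MeasureTheory.volume.withDensity (fun c : ℝ => ENNReal.ofReal
        (if 0 < c then
          (Real.sqrt (2 * Real.pi))⁻¹ * (Real.sqrt c)⁻¹ * Real.exp (-(c / 2))
        else 0)) := by
  obtain ⟨hl, hl1⟩ := hlam
  have hnd : 0 < w ∨ 0 < lam ∧ 0 < 1 - lam := by
    rcases hw.lt_or_eq with h | h
    · exact Or.inl h
    · obtain ⟨h0, h1⟩ := hw0 h.symm
      exact Or.inr ⟨lt_of_le_of_ne hl h0.symm, sub_pos.2 (lt_of_le_of_ne hl1 h1)⟩
  refine Measure.ext_of_lintegral _ fun F hF => ?_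
  rw [lintegral_map hF (by fun_prop), lintegral_withDensity_eq_lintegral_mul _ ?_ hF]
  · exact lintegral_nuMeasure_gammaMap hw hl (sub_nonneg.2 hl1) (add_sub_cancel _ _) hnd hF
  · exact (Measurable.ite measurableSet_Ioi (by fun_prop) measurable_const).ennreal_ofReal
end
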